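/- Let k ≥ 2, n = k(k+1)/2, and let α be an n-tuple of pairwise independent irrational numbers with k(α) = k. Then there exists T > 1 such that for every t_0 ≥ T, with the functions enumerated as ψ_{i,j} according to their decreasing order at t_0, each function ψ_{i,i} (1 ≤ i ≤ k) is discontinuous at every point t_{i+sk} (s ≥ 0) of the sequence of moments of permutation changes, and is continuous at every other point t_j (j ≥ 1) of that sequence. -/

import Mathlib

/-- Distance from `x` to the nearest integer. -/
noncomputable def distToInt (x : ℝ) : ℝ := |x - round x|

/-- The irrationality measure function `ψ_α(t) = min_{1 ≤ q ≤ t} ‖qα‖`. -/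
noncomputable def psi (α : ℝ) (t : ℝ) : ℝ :=
  sInf ((fun q : ℤ => distToInt ((q : ℝ) * α)) '' {q : ℤ | 1 ≤ q ∧ (q : ℝ) ≤ t})

/-- An `n`-tuple is pairwise independent if eventually all the values
`ψ_{α_i}(t)` are pairwise distinct. -/
def PairwiseIndependent {n : ℕ} (α : Fin n → ℝ) : Prop :=
  ∃ T : ℝ, 0 ≤ T ∧ ∀ t : ℝ, T ≤ t → ∀ i j : Fin n, i ≠ j → psi (α i) t ≠ psi (α j) t

/-- `v : Fin n → Fin n` is the order vector of `α` at time `t`: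
`ψ_{α_{v 0}}(t) > ψ_{α_{v 1}}(t) > … > ψ_{α_{v (n-1)}}(t)`. -/
def IsOrderVec {n : ℕ} (α : Fin n → ℝ) (t : ℝ) (v : Fin n → Fin n) : Prop :=
  Function.Bijective v ∧
    ∀ p q : Fin n, p < q → psi (α (v p)) t > psi (α (v q)) t

/-- The order vector `v` occurs at arbitrarily large times. -/
def OccursInfinitely {n : ℕ} (α : Fin n → ℝ) (v : Fin n → Fin n) : Prop :=
  ∀ T : ℝ, ∃ t : ℝ, T < t ∧ IsOrderVec α t v

/-- `k(α)`: the number of distinct order vectors occurring for arbitrarily large `t`. -/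
noncomputable def kAlpha {n : ℕ} (α : Fin n → ℝ) : ℕ :=
  Nat.card {v : Fin n → Fin n | OccursInfinitely α v}

/-- The relative order of the functions `ψ_{α_i}` is the same at times `t` and `t'`
(i.e. the order vectors coincide). -/
def SameOrder {n : ℕ} (α : Fin n → ℝ) (t t' : ℝ) : Prop :=
  ∀ i j : Fin n, (psi (α i) t < psi (α j) t ↔ psi (α i) t' < psi (α j) t')

/-- `ts` is a sequence of moments of permutation changes:
`ts (i+1) = min { t > ts i : v_α(t) ≠ v_α(ts i) }`. -/
def IsChangeSeq {n : ℕ} (α : Fin n → ℝ) (ts : ℕ → ℝ) : Prop :=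
  ∀ i : ℕ, IsLeast {t : ℝ | ts i < t ∧ ¬ SameOrder α (ts i) t} (ts (i + 1))

/-- The set of positions `(j,l)`, `1 ≤ j ≤ l ≤ k` (here `0`-based). -/
def PairIdx (k : ℕ) := {p : Fin k × Fin k // p.1 ≤ p.2}

/-- Construct a position from `0`-based indices `j ≤ l < k`. -/
def mkPos {k : ℕ} (j l : ℕ) (hj : j ≤ l) (hl : l < k) : PairIdx k :=
  ⟨(⟨j, lt_of_le_of_lt hj hl⟩, ⟨l, hl⟩), Fin.mk_le_mk.mpr hj⟩

/-- The position permutation underlying `π`: one has `π(u) = u ∘ tau`.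
In `1`-based notation: `tau (i,i) = (i+1,i+1)` for `i < k`, `tau (k,k) = (1,1)`,
`tau (i,k) = (1,i+1)` for `i < k`, and `tau (i,j) = (i+1,j+1)` otherwise. -/
def tau {k : ℕ} (p : PairIdx k) : PairIdx k :=
  if h2 : p.1.2.val = k - 1 then
    if h1 : p.1.1.val = k - 1 then
      ⟨(⟨0, by have := p.1.2.isLt; omega⟩, ⟨0, by have := p.1.2.isLt; omega⟩), le_refl _⟩
    else
      ⟨(⟨0, by have := p.1.2.isLt; omega⟩,
        ⟨p.1.1.val + 1, by have := p.1.1.isLt; omega⟩),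
       Fin.mk_le_mk.mpr (by omega)⟩
  else
    ⟨(⟨p.1.1.val + 1, by have h := p.1.2.isLt; have h' : p.1.1.val ≤ p.1.2.val := p.2; omega⟩,
      ⟨p.1.2.val + 1, by have h := p.1.2.isLt; omega⟩),
     Fin.mk_le_mk.mpr (by have h' : p.1.1.val ≤ p.1.2.val := p.2; omega)⟩

/-- The action of `π` on vectors indexed by positions: `π(u) = u ∘ tau`. -/
def piMap {k : ℕ} {X : Type*} (u : PairIdx k → X) : PairIdx k → X :=
  fun p => u (tau p)

/-- The (`0`-based) linear position of the pair `(j,l)` in the special enumeration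
`u_{1,1}, u_{1,k}, u_{1,k-1}, …, u_{1,2}, u_{2,2}, u_{2,k}, …, u_{k,k}`. -/
def posIdx {k : ℕ} (p : PairIdx k) : ℕ :=
  (p.1.1.val * k - p.1.1.val * (p.1.1.val - 1) / 2) +
    (if p.1.2.val = p.1.1.val then 0 else k - p.1.2.val)

/-- `v : PairIdx k → Fin n` is the order vector of `α` at time `t`, written in the
special pair enumeration: the function at position `p` is larger than the one at
position `q` whenever `p` precedes `q` in the enumeration. -/
def IsOrderVecP {n k : ℕ} (α : Fin n → ℝ) (t : ℝ) (v : PairIdx k → Fin n) : Prop :=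
  Function.Bijective v ∧
    ∀ p q : PairIdx k, posIdx p < posIdx q → psi (α (v p)) t > psi (α (v q)) t

/-- Denominator `q_m` of the `m`-th convergent of the continued fraction of `α`. -/
noncomputable def cfDen (α : ℝ) (m : ℕ) : ℝ := (GenContFract.of α).dens m

/-- The orbit equivalence relation of the map `tau` on positions. -/
def orbitSetoid (k : ℕ) : Setoid (PairIdx k) where
  r p q := ∃ a b : ℕ, (fun x : PairIdx k => tau x)^[a] p = (fun x : PairIdx k => tau x)^[b] q
  iseqv := by
    constructor
    · exact fun p => ⟨0, 0, rfl⟩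
    · rintro p q ⟨a, b, h⟩; exact ⟨b, a, h.symm⟩
    · rintro p q r ⟨a, b, h1⟩ ⟨c, d, h2⟩
      refine ⟨c + a, b + d, ?_⟩
      rw [Function.iterate_add_apply, h1, ← Function.iterate_add_apply,
        Nat.add_comm c b, Function.iterate_add_apply, h2, ← Function.iterate_add_apply]

/-- Signed distance from `q α` to the nearest integer. -/
noncomputable def err (α : ℝ) (q : ℕ) : ℝ := q * α - round (q * α)

/-- Distance from `q α` to the nearest integer. -/
noncomputable def dd (α : ℝ) (q : ℕ) : ℝ := |err α q|

/-- `q` is a denominator of a best approximation to `α`. -/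
def IsBest (α : ℝ) (q : ℕ) : Prop := 1 ≤ q ∧ ∀ r, 1 ≤ r → r < q → dd α q < dd α r

/-- `x < m` are consecutive denominators of best approximations to `α`. -/
def Consec (α : ℝ) (x m : ℕ) : Prop :=
  x < m ∧ IsBest α x ∧ IsBest α m ∧ ∀ q, x < q → q < m → ¬ IsBest α q

lemma dd_le (α : ℝ) (q : ℕ) (z : ℤ) : dd α q ≤ |q * α - z| := round_le _ _

lemma err_ne_zero {α : ℝ} (h : Irrational α) {q : ℕ} (hq : 1 ≤ q) : err α q ≠ 0 := by
  intro h0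
  have h1 : Irrational ((q : ℝ) * α) := h.natCast_mul (by omega)
  exact h1.ne_int (round ((q : ℝ) * α)) (by unfold err at h0; linarith)

lemma dd_pos {α : ℝ} (h : Irrational α) {q : ℕ} (hq : 1 ≤ q) : 0 < dd α q :=
  abs_pos.mpr (err_ne_zero h hq)

lemma isBest_one (α : ℝ) : IsBest α 1 := ⟨le_rfl, fun r h1 h2 => by omega⟩

/-- Any `q ≥ 1` is dominated by a best approximation denominator not exceeding it. -/
lemma exists_best_le (α : ℝ) (q : ℕ) (hq : 1 ≤ q) :
    ∃ r, r ≤ q ∧ IsBest α r ∧ dd α r ≤ dd α q := by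
  induction q using Nat.strong_induction_on with
  | _ q ih =>
    by_cases hb : IsBest α q
    · exact ⟨q, le_rfl, hb, le_rfl⟩
    · unfold IsBest at hb
      push Not at hb
      obtain ⟨r, h1, h2, h3⟩ := hb hq
      obtain ⟨s, hs1, hs2, hs3⟩ := ih r h2 h1
      exact ⟨s, by omega, hs2, hs3.trans h3⟩

lemma IsBest.lt {α : ℝ} {x y : ℕ} (hx : IsBest α x) (hy : IsBest α y) (h : x < y) :
    dd α y < dd α x := hy.2 x hx.1 h

lemma Consec.dd_le_of_lt {α : ℝ} {x m : ℕ} (h : Consec α x m) {q : ℕ} (h1 : 1 ≤ q)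
    (h2 : q < m) : dd α x ≤ dd α q := by
  obtain ⟨r, hr1, hr2, hr3⟩ := exists_best_le α q h1
  refine le_trans ?_ hr3
  rcases lt_trichotomy r x with h' | h' | h'
  · exact (hr2.lt h.2.1 h').le
  · rw [h']
  · exact absurd hr2 (h.2.2.2 r h' (by omega))

lemma exists_consec {α : ℝ} {m : ℕ} (hm : IsBest α m) (h2 : 2 ≤ m) : ∃ x, Consec α x m := by
  classical
  have hP : IsBest α 1 := isBest_one α
  let x := Nat.findGreatest (fun q => IsBest α q) (m - 1)
  have hx1 : IsBest α x := Nat.findGreatest_spec (P := fun q => IsBest α q) (m := 1) (by omega) hP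
  have hx2 : x ≤ m - 1 := Nat.findGreatest_le _
  refine ⟨x, by omega, hx1, hm, fun q h3 h4 => ?_⟩
  exact Nat.findGreatest_is_greatest h3 (by omega)

lemma Consec.mul_le_one {α : ℝ} {x m : ℕ} (h : Consec α x m) : (m : ℝ) * dd α x ≤ 1 := by
  have hx := h.2.1.1
  have hm := h.1
  obtain ⟨j, k, hk0, hk, hjk⟩ := Real.exists_int_int_abs_mul_sub_le α (n := m - 1) (by omega)
  lift k to ℕ using hk0.le
  have h1 := h.dd_le_of_lt (q := k) (by omega) (by omega)
  have h2 := dd_le α k j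
  have h3 : ((m - 1 : ℕ) : ℝ) + 1 = m := by
    rw [Nat.cast_sub (by omega)]; push_cast; ring
  rw [h3] at hjk
  have hm0 : (0 : ℝ) < m := by exact_mod_cast (by omega : 0 < m)
  have h4 : dd α x ≤ 1 / m := h1.trans (h2.trans (by simpa using hjk))
  rw [le_div_iff₀ hm0] at h4
  linarith

/-- The determinant of two consecutive best approximations. -/
lemma Consec.det {α : ℝ} (ha : Irrational α) {x m : ℕ} (h : Consec α x m) :
    err α x * err α m < 0 ∧ (m : ℝ) * dd α x + x * dd α m = 1 ∧
      |(x : ℤ) * round (m * α) - m * round (x * α)| = 1 := by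
  have hx := h.2.1.1
  have hm := h.1
  have hx0 : (0 : ℝ) < x := by exact_mod_cast hx
  have hxm : (x : ℝ) < m := by exact_mod_cast hm
  have h1 := h.mul_le_one
  have h2 := h.2.1.lt h.2.2.1 hm
  have h3 := dd_pos ha h.2.2.1.1
  have hlt : (x : ℝ) * dd α m < m * dd α x := by nlinarith
  have hxm' : 0 < (x : ℝ) * dd α m := by positivity
  set D : ℤ := (x : ℤ) * round (m * α) - m * round (x * α) with hD
  have hDr : (D : ℝ) = m * err α x - x * err α m := by
    rw [hD]; unfold err; push_cast; ring
  unfold dd at *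
  have hneg : err α x * err α m < 0 := by
    by_contra hcon
    push Not at hcon
    have key : |(D : ℝ)| < 1 ∧ (D : ℝ) ≠ 0 := by
      rw [hDr]
      rcases le_total 0 (err α x) with a | a <;> rcases le_total 0 (err α m) with b | b
      · rw [abs_of_nonneg a] at *
        rw [abs_of_nonneg b] at *
        rw [abs_of_pos (by linarith)]
        constructor <;> [skip; apply ne_of_gt] <;> linarith
      · have : err α x * err α m = 0 := le_antisymm (mul_nonpos_of_nonneg_of_nonpos a b) hcon
        rcases mul_eq_zero.mp this with h' | h'
        · exact absurd h' (err_ne_zero ha hx)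
        · exact absurd h' (err_ne_zero ha h.2.2.1.1)
      · have : err α x * err α m = 0 := le_antisymm (mul_nonpos_of_nonpos_of_nonneg a b) hcon
        rcases mul_eq_zero.mp this with h' | h'
        · exact absurd h' (err_ne_zero ha hx)
        · exact absurd h' (err_ne_zero ha h.2.2.1.1)
      · rw [abs_of_nonpos a] at *
        rw [abs_of_nonpos b] at *
        rw [abs_of_neg (by linarith)]
        constructor <;> [skip; apply ne_of_lt] <;> linarith
    have k1 : |D| < 1 := by exact_mod_cast key.1
    exact key.2 (by exact_mod_cast Int.abs_lt_one_iff.mp k1)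
  have habs : |(D : ℝ)| = m * |err α x| + x * |err α m| := by
    rw [hDr]
    rcases mul_neg_iff.mp hneg with ⟨a, b⟩ | ⟨a, b⟩
    · rw [abs_of_pos a, abs_of_neg b, abs_of_pos (by nlinarith)]; ring
    · rw [abs_of_neg a, abs_of_pos b, abs_of_neg (by nlinarith)]; ring
  have hD1 : |D| = 1 := by
    have k1 : |(D : ℝ)| < 2 := by rw [habs]; linarith
    have k2 : 0 < |(D : ℝ)| := by rw [habs]; linarith
    have k1' : |D| < 2 := by exact_mod_cast k1
    have k2' : 0 < |D| := by exact_mod_cast k2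
    omega
  refine ⟨hneg, ?_, hD1⟩
  rw [← habs]
  exact_mod_cast hD1

lemma Consec.identity {α : ℝ} (ha : Irrational α) {x m : ℕ} (h : Consec α x m) :
    (m : ℝ) * dd α x + x * dd α m = 1 := (h.det ha).2.1

lemma Consec.coprime {α : ℝ} (ha : Irrational α) {x m : ℕ} (h : Consec α x m) :
    Nat.Coprime x m := by
  have h1 := (h.det ha).2.2
  rw [← Nat.isCoprime_iff_coprime]
  rcases (abs_eq (by norm_num)).mp h1 with h2 | h2
  · exact ⟨round (m * α), - round (x * α), by linarith⟩
  · exact ⟨- round (m * α), round (x * α), by linarith⟩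

lemma Consec.step {α : ℝ} (ha : Irrational α) {p x m : ℕ} (h1 : Consec α p x)
    (h2 : Consec α x m) :
    ∃ A : ℕ, 1 ≤ A ∧ m = A * x + p ∧ dd α p = A * dd α x + dd α m := by
  obtain ⟨s1, i1, -⟩ := h1.det ha
  obtain ⟨s2, i2, d2⟩ := h2.det ha
  have hx0 : 0 < x := h2.2.1.1
  have hx : (0 : ℝ) < x := by exact_mod_cast hx0
  have hpm : p < m := h1.1.trans h2.1
  have key : (x : ℝ) * (err α m - err α p) = ((m : ℝ) - p) * err α x := by
    unfold dd at i1 i2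
    rcases mul_neg_iff.mp s1 with ⟨a, b⟩ | ⟨a, b⟩
    · have c : 0 < err α m := by
        by_contra hc; push Not at hc; nlinarith
      rw [abs_of_pos a, abs_of_neg b] at i1
      rw [abs_of_neg b, abs_of_pos c] at i2
      linarith
    · have c : err α m < 0 := by
        by_contra hc; push Not at hc; nlinarith
      rw [abs_of_neg a, abs_of_pos b] at i1
      rw [abs_of_pos b, abs_of_neg c] at i2
      linarith
  have hmul : (x : ℤ) * (round (m * α) - round (p * α)) = ((m : ℤ) - p) * round (x * α) := by
    have : (x : ℝ) * (round (m * α) - round (p * α)) = ((m : ℝ) - p) * round (x * α) := by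
      unfold err at key; linarith
    exact_mod_cast this
  have hcop : IsCoprime (x : ℤ) (round (x * α)) := by
    rcases (abs_eq (by norm_num)).mp d2 with h3 | h3
    · exact ⟨round (m * α), - (m : ℤ), by linarith⟩
    · exact ⟨- round (m * α), (m : ℤ), by linarith⟩
  have hdvd : (x : ℤ) ∣ (m : ℤ) - p := hcop.dvd_of_dvd_mul_right ⟨_, hmul.symm⟩
  have hdvd' : x ∣ m - p := by
    rw [← Nat.cast_sub hpm.le] at hdvd
    exact_mod_cast hdvd
  obtain ⟨A, hA⟩ := hdvd'
  have hA1 : 1 ≤ A := by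
    rcases Nat.eq_zero_or_pos A with h | h
    · subst h; omega
    · exact h
  have hmA : m = A * x + p := by rw [mul_comm]; omega
  refine ⟨A, hA1, hmA, ?_⟩
  have hA0 : (0 : ℝ) < A := by exact_mod_cast hA1
  have hmr : (m : ℝ) = A * x + p := by exact_mod_cast hmA
  have hval : err α p = err α m - A * err α x := by
    have : (x : ℝ) * (err α m - err α p) = x * (A * err α x) := by rw [key, hmr]; ring
    have := mul_left_cancel₀ hx.ne' this
    linarith
  unfold dd
  rcases mul_neg_iff.mp s2 with ⟨a, b⟩ | ⟨a, b⟩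
  · rw [abs_of_pos a, abs_of_neg b, abs_of_neg (by rw [hval]; nlinarith), hval]; ring
  · rw [abs_of_neg a, abs_of_pos b, abs_of_pos (by rw [hval]; nlinarith), hval]; ring

lemma exists_dd_lt {α : ℝ} {ε : ℝ} (hε : 0 < ε) :
    ∃ q, 1 ≤ q ∧ dd α q < ε := by
  obtain ⟨n, hn⟩ := exists_nat_one_div_lt hε
  obtain ⟨j, k, hk0, hk, hjk⟩ := Real.exists_int_int_abs_mul_sub_le α (n := n + 1) (by omega)
  lift k to ℕ using hk0.le
  refine ⟨k, by omega, (dd_le α k j).trans_lt ?_⟩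
  refine lt_of_le_of_lt (by simpa using hjk) (lt_of_le_of_lt ?_ hn)
  rw [inv_eq_one_div]
  apply one_div_le_one_div_of_le <;> [positivity; linarith]

lemma exists_best_gt {α : ℝ} (ha : Irrational α) (N : ℕ) : ∃ m, N < m ∧ IsBest α m := by
  have hfin : ∃ ε > 0, ∀ q, 1 ≤ q → q ≤ N → ε ≤ dd α q := by
    induction N with
    | zero => exact ⟨1, one_pos, fun q h1 h2 => by omega⟩
    | succ N ih =>
      obtain ⟨ε, h0, h⟩ := ih
      refine ⟨min ε (dd α (N + 1)), lt_min h0 (dd_pos ha (by omega)), fun q h1 h2 => ?_⟩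
      rcases Nat.lt_or_ge N q with h3 | h3
      · have : q = N + 1 := by omega
        subst this; exact min_le_right _ _
      · exact (min_le_left _ _).trans (h q h1 h3)
  obtain ⟨ε, h0, h⟩ := hfin
  obtain ⟨q, hq1, hq2⟩ := exists_dd_lt (α := α) h0
  obtain ⟨r, hr1, hr2, hr3⟩ := exists_best_le α q hq1
  refine ⟨r, ?_, hr2⟩
  by_contra hcon
  have := h r hr2.1 (by omega)
  linarith

lemma IsBest.exists_next {α : ℝ} (ha : Irrational α) {x : ℕ} (hx : IsBest α x) :
    ∃ m, Consec α x m := by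
  classical
  have hex := exists_best_gt ha x
  have hs := Nat.find_spec hex
  exact ⟨Nat.find hex, hs.1, hx, hs.2, fun q h1 h2 h3 => Nat.find_min hex h2 ⟨h1, h3⟩⟩

lemma IsBest.mul_lt_one {α : ℝ} (ha : Irrational α) {x : ℕ} (hx : IsBest α x) :
    (x : ℝ) * dd α x < 1 := by
  obtain ⟨m, hm⟩ := hx.exists_next ha
  have h1 := hm.identity ha
  have h2 : (x : ℝ) < m := by exact_mod_cast hm.1
  have h3 := dd_pos ha hx.1
  have h4 := dd_pos ha hm.2.2.1.1
  have h5 : (0 : ℝ) < x := by exact_mod_cast hx.1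
  nlinarith [mul_pos h5 h4]

/-- The largest denominator of a best approximation to `α` not exceeding `m`. -/
noncomputable def lastBest (α : ℝ) (m : ℕ) : ℕ :=
  open Classical in Nat.findGreatest (fun q => IsBest α q) m

/-- The value of the irrationality measure function at the integer `m`. -/
noncomputable def mu (α : ℝ) (m : ℕ) : ℝ := dd α (lastBest α m)

lemma lastBest_le (α : ℝ) (m : ℕ) : lastBest α m ≤ m := by
  classical exact Nat.findGreatest_le _

lemma lastBest_isBest (α : ℝ) {m : ℕ} (hm : 1 ≤ m) : IsBest α (lastBest α m) := by
  classical
  exact Nat.findGreatest_spec (P := fun q => IsBest α q) hm (isBest_one α)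

lemma le_lastBest {α : ℝ} {q m : ℕ} (hq : IsBest α q) (hqm : q ≤ m) : q ≤ lastBest α m := by
  classical
  exact Nat.le_findGreatest hqm hq

lemma Consec.lastBest_eq {α : ℝ} {x m s : ℕ} (h : Consec α x m) (h1 : x ≤ s) (h2 : s < m) :
    lastBest α s = x := by
  refine le_antisymm ?_ (le_lastBest h.2.1 h1)
  by_contra hcon
  exact h.2.2.2 _ (by omega) ((lastBest_le α s).trans_lt h2)
    (lastBest_isBest α (h.2.1.1.trans h1))

lemma Consec.mu_eq {α : ℝ} {x m s : ℕ} (h : Consec α x m) (h1 : x ≤ s) (h2 : s < m) :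
    mu α s = dd α x := by rw [mu, h.lastBest_eq h1 h2]

lemma Consec.mu_pred {α : ℝ} {x m : ℕ} (h : Consec α x m) : mu α (m - 1) = dd α x :=
  h.mu_eq (by have := h.1; omega) (by have := h.1; omega)

lemma IsBest.mu_eq {α : ℝ} {q : ℕ} (h : IsBest α q) : mu α q = dd α q := by
  rw [mu, le_antisymm (lastBest_le α q) (le_lastBest h le_rfl)]

lemma mu_anti (α : ℝ) {a b : ℕ} (ha : 1 ≤ a) (hab : a ≤ b) : mu α b ≤ mu α a := by
  have h1 := lastBest_isBest α ha
  have h2 := lastBest_isBest α (ha.trans hab)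
  rcases (le_lastBest h1 ((lastBest_le α a).trans hab)).eq_or_lt with h | h
  · rw [mu, mu, ← h]
  · exact (h1.lt h2 h).le

lemma mu_eq_of_not_isBest {α : ℝ} {m : ℕ} (hm : 1 ≤ m) (h : ¬ IsBest α m) :
    mu α m = mu α (m - 1) := by
  classical
  obtain ⟨j, rfl⟩ : ∃ j, m = j + 1 := ⟨m - 1, by omega⟩
  rw [mu, mu, lastBest, Nat.findGreatest_of_not h]
  rfl

lemma IsBest.mu_lt {α : ℝ} {m : ℕ} (h : IsBest α m) (hm : 2 ≤ m) : mu α m < mu α (m - 1) := by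
  obtain ⟨x, hx⟩ := exists_consec h hm
  rw [hx.mu_pred, h.mu_eq]
  exact hx.2.1.lt h hx.1

lemma Consec.exists_of_isBest_lt {α : ℝ} (ha : Irrational α) {m : ℕ} (hm : 1 ≤ m) :
    ∃ x', Consec α (lastBest α m) x' ∧ m < x' := by
  obtain ⟨x', hx'⟩ := (lastBest_isBest α hm).exists_next ha
  refine ⟨x', hx', ?_⟩
  by_contra hcon
  have := le_lastBest hx'.2.2.1 (by omega : x' ≤ m)
  have := hx'.1
  omega

lemma Consec.eq_right {α : ℝ} {x m m' : ℕ} (h : Consec α x m) (h' : Consec α x m') : m = m' := by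
  rcases lt_trichotomy m m' with h1 | h1 | h1
  · exact absurd h.2.2.1 (h'.2.2.2 m h.1 h1)
  · exact h1
  · exact absurd h'.2.2.1 (h.2.2.2 m' h'.1 h1)

section Pair

variable {α β : ℝ} {x y t : ℕ}

lemma Consec.lt_of_lt_of_lt (ha : Irrational α) (hb : Irrational β) (h1 : Consec α x t)
    (h2 : Consec β y t) (hd : dd α x < dd β y) (ht : dd α t < dd β t) : y < x := by
  have i1 := h1.identity ha
  have i2 := h2.identity hb
  have ht0 : (0 : ℝ) < t := by exact_mod_cast h1.2.2.1.1
  have hy0 : (0 : ℝ) < y := by exact_mod_cast h2.2.1.1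
  have p := dd_pos ha h1.2.2.1.1
  by_contra hcon
  have hxy : (x : ℝ) ≤ y := by exact_mod_cast not_lt.mp hcon
  nlinarith

lemma Consec.dd_lt_dd_prev (ha : Irrational α) (hb : Irrational β) (h1 : Consec α x t)
    (h2 : Consec β y t) {p : ℕ} (hp : Consec α p x) : dd β y < dd α p := by
  have i1 := h1.identity ha
  have i2 := h2.identity hb
  obtain ⟨A, hA, -, hs⟩ := hp.step ha h1
  have ht0 : (0 : ℝ) < t := by exact_mod_cast h1.2.2.1.1
  have hy0 : (0 : ℝ) < y := by exact_mod_cast h2.2.1.1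
  have hxt : (x : ℝ) < t := by exact_mod_cast h1.1
  have q1 := dd_pos ha h1.2.2.1.1
  have q2 := dd_pos ha h1.2.1.1
  have q3 := dd_pos hb h2.2.2.1.1
  have hA' : (1 : ℝ) ≤ A := by exact_mod_cast hA
  have k1 : dd α x + dd α t ≤ dd α p := by rw [hs]; nlinarith
  have k2 : (t : ℝ) * dd β y < t * dd α p := by nlinarith [mul_pos hy0 q3]
  exact lt_of_mul_lt_mul_left k2 ht0.le

/-- Expansion of a later pair of consecutive denominators in terms of an earlier one. -/
lemma Consec.expansion (ha : Irrational α) {w x₁ : ℕ} (h0 : Consec α w x₁) :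
    ∀ t x, Consec α x t → w ≤ x → ∃ (B C B' C' : ℕ) (σ : ℝ), |σ| = 1 ∧
      t = B * x₁ + C * w ∧ x = B' * x₁ + C' * w ∧ 1 ≤ C + C' ∧ (x₁ < t → 1 ≤ C) ∧
      (t : ℝ) * dd α w = B + σ * (w * dd α t) ∧ (x : ℝ) * dd α w = B' - σ * (w * dd α x) := by
  intro t
  induction t using Nat.strong_induction_on with
  | _ t ih =>
    intro x hx hwx
    rcases hwx.eq_or_lt with rfl | hlt
    · obtain rfl := h0.eq_right hx
      have i := h0.identity ha
      refine ⟨1, 0, 0, 1, -1, by norm_num, by ring, by ring, by norm_num, fun h => by omega,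
        by push_cast; linarith, by push_cast; ring⟩
    · have hw := h0.2.1.1
      obtain ⟨s, hs⟩ := exists_consec hx.2.1 (by omega)
      have hws : w ≤ s := by
        by_contra hcon
        exact hs.2.2.2 w (by omega) hlt h0.2.1
      obtain ⟨B, C, B', C', σ, e1, e2, e3, e4, e5, e6, e7⟩ := ih x hx.1 s hs hws
      obtain ⟨A, hA, hm, hd⟩ := hs.step ha hx
      have hmr : (t : ℝ) = A * x + s := by exact_mod_cast hm
      refine ⟨A * B + B', A * C + C', B, C, -σ, by rwa [abs_neg], ?_, e2, ?_, ?_, ?_, ?_⟩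
      · rw [hm, e2, e3]; ring
      · nlinarith
      · intro _; nlinarith
      · push_cast
        rw [hmr, add_mul, mul_assoc, e6, e7, hd]; ring
      · linarith

lemma Consec.mu_lt_mu_pred (ha : Irrational α) (hb : Irrational β) (h1 : Consec α x t)
    (h2 : Consec β y t) (hyx : y < x) (ht : dd α t < dd β t) (hy : 2 ≤ y) :
    mu α (y - 1) < mu β (y - 1) := by
  obtain ⟨z, hz⟩ := exists_consec h2.2.1 hy
  rw [hz.mu_pred, mu]
  obtain ⟨x₁, hx₁, hlt⟩ := Consec.exists_of_isBest_lt ha (m := y - 1) (by omega)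
  set w := lastBest α (y - 1) with hw
  have hwy : w ≤ y - 1 := lastBest_le _ _
  have hx₁x : x₁ ≤ x := by
    by_contra hcon
    exact hx₁.2.2.2 x (by omega) (by omega) h1.2.1
  obtain ⟨B, C, B', C', σ, e1, e2, -, -, e5, e6, -⟩ := hx₁.expansion ha t x h1 (by omega)
  have hC := e5 (hx₁x.trans_lt h1.1)
  obtain ⟨A, hA, hm, hd⟩ := hz.step hb h2
  have hmr : (t : ℝ) = A * y + z := by exact_mod_cast hm
  have i2 := h2.identity hb
  have k1 : (t : ℝ) * dd β z = A + z * dd β t := by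
    have : (t : ℝ) * dd β z = A * (t * dd β y) + t * dd β t := by rw [hd]; ring
    rw [this, eq_sub_of_add_eq i2]
    linear_combination dd β t * hmr
  have ht0 : (0 : ℝ) < t := by exact_mod_cast h1.2.2.1.1
  have hz0 : (0 : ℝ) < z := by exact_mod_cast hz.2.1.1
  have hw0 : (0 : ℝ) < w := by exact_mod_cast hx₁.2.1.1
  have q1 := dd_pos ha h1.2.2.1.1
  have k2 : σ * (w * dd α t) ≤ w * dd α t := by
    have : σ ≤ 1 := by rw [← e1]; exact le_abs_self σ
    nlinarith [mul_pos hw0 q1]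
  have hzy := hz.1
  have hBA : B ≤ A := by
    by_contra hcon
    have : (A + 1) * y ≤ B * x₁ := Nat.mul_le_mul (by omega) (by omega)
    nlinarith
  have k3 : (t : ℝ) * dd α w < t * dd β z := by
    rcases hBA.eq_or_lt with rfl | hlt'
    · have hwz : w ≤ z := by
        have : B * y ≤ B * x₁ := Nat.mul_le_mul le_rfl (by omega)
        nlinarith
      have hwz' : (w : ℝ) ≤ z := by exact_mod_cast hwz
      rw [e6, k1]
      nlinarith
    · have hB : (B : ℝ) + 1 ≤ A := by exact_mod_cast hlt'
      have k4 := h1.2.2.1.mul_lt_one ha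
      have hwt : (w : ℝ) ≤ t := by
        have := h1.1
        exact_mod_cast (by omega : w ≤ t)
      rw [e6, k1]
      have q2 := dd_pos hb h2.2.2.1.1
      nlinarith [mul_pos hz0 q2]
  exact lt_of_mul_lt_mul_left k3 ht0.le

/-- If both functions jump at `t`, the one that is smaller just before `t` has become
smaller at its own previous jump. -/
lemma Consec.swap_at_prev (ha : Irrational α) (hb : Irrational β) (h1 : Consec α x t)
    (h2 : Consec β y t) (hxy : x ≠ y) (hd : dd α x < dd β y) (ht : dd α t ≠ dd β t)
    (hx : 2 ≤ x) : mu β (x - 1) < mu α (x - 1) := by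
  rcases hxy.lt_or_gt with h | h
  · refine h2.mu_lt_mu_pred hb ha h1 h (lt_of_le_of_ne ?_ ht.symm) hx
    by_contra hcon
    exact absurd (h1.lt_of_lt_of_lt ha hb h2 hd (not_le.mp hcon)) (by omega)
  · obtain ⟨p, hp⟩ := exists_consec h1.2.1 hx
    rw [hp.mu_pred, h2.mu_eq (by omega) (by have := h1.1; omega)]
    exact h1.dd_lt_dd_prev ha hb h2 hp

lemma Consec.isBest_iff (ha : Irrational α) (hb : Irrational β) :
    ∀ t x, Consec α x t → Consec β x t → ∀ q ≤ t, (IsBest α q ↔ IsBest β q) := by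
  intro t
  induction t using Nat.strong_induction_on with
  | _ t ih =>
    intro x h1 h2 q hq
    rcases hq.eq_or_lt with rfl | hq
    · exact iff_of_true h1.2.2.1 h2.2.2.1
    rcases lt_or_ge x q with hxq | hxq
    · exact iff_of_false (h1.2.2.2 q hxq hq) (h2.2.2.2 q hxq hq)
    rcases (h1.2.1.1).eq_or_lt with h | h
    · subst h
      rcases Nat.eq_zero_or_pos q with h' | h'
      · subst h'
        exact iff_of_false (fun h => by have := h.1; omega) (fun h => by have := h.1; omega)
      · obtain rfl : q = 1 := by omega
        exact iff_of_true (isBest_one _) (isBest_one _)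
    · obtain ⟨p, hp⟩ := exists_consec h1.2.1 h
      obtain ⟨p', hp'⟩ := exists_consec h2.2.1 h
      obtain ⟨A, -, hA, -⟩ := hp.step ha h1
      obtain ⟨A', -, hA', -⟩ := hp'.step hb h2
      have e1 : t % x = p := by rw [hA, Nat.mul_add_mod', Nat.mod_eq_of_lt hp.1]
      have e2 : t % x = p' := by rw [hA', Nat.mul_add_mod', Nat.mod_eq_of_lt hp'.1]
      obtain rfl : p = p' := e1.symm.trans e2
      exact ih x h1.1 p hp hp' q hxq

/-- Two eventually distinct functions have only finitely many common pairs of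
consecutive jumps. -/
lemma exists_forall_not_consec (ha : Irrational α) (hb : Irrational β) {M : ℕ}
    (hM : ∀ m ≥ M, mu α m ≠ mu β m) :
    ∃ T, ∀ t ≥ T, ∀ x, ¬ (Consec α x t ∧ Consec β x t) := by
  by_contra! hcon
  have hiff : ∀ q, IsBest α q ↔ IsBest β q := fun q => by
    obtain ⟨t, ht, x, h1, h2⟩ := hcon q
    exact h1.isBest_iff ha hb t x h2 q ht
  have hcon' : ∀ x t, Consec α x t → Consec β x t := fun x t h =>
    ⟨h.1, (hiff _).1 h.2.1, (hiff _).1 h.2.2.1, fun q a b c => h.2.2.2 q a b ((hiff _).2 c)⟩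
  obtain ⟨r₀, hr, hr₀⟩ := exists_best_gt ha M
  have hne : dd α r₀ - dd β r₀ ≠ 0 := by
    have := hM r₀ hr.le
    rw [hr₀.mu_eq, ((hiff _).1 hr₀).mu_eq] at this
    exact sub_ne_zero.mpr this
  have hmono : ∀ r ≥ r₀, IsBest α r → |dd α r₀ - dd β r₀| ≤ |dd α r - dd β r| := by
    intro r
    induction r using Nat.strong_induction_on with
    | _ r ih =>
      intro hrr hb'
      rcases hrr.eq_or_lt with rfl | hlt
      · exact le_rfl
      · have := hr₀.1
        obtain ⟨s, hs⟩ := exists_consec hb' (by omega)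
        have hs0 : r₀ ≤ s := by
          by_contra h
          exact hs.2.2.2 r₀ (by omega) hlt hr₀
        refine (ih s hs.1 hs0 hs.2.1).trans ?_
        have i1 := hs.identity ha
        have i2 := (hcon' _ _ hs).identity hb
        have key : (r : ℝ) * (dd α s - dd β s) = - (s * (dd α r - dd β r)) := by linarith
        have key2 := congrArg abs key
        rw [abs_neg, abs_mul, abs_mul, Nat.abs_cast, Nat.abs_cast] at key2
        have hr0 : (0 : ℝ) < r := by exact_mod_cast hb'.1
        have hsr : (s : ℝ) ≤ r := by exact_mod_cast hs.1.le
        refine le_of_mul_le_mul_left ?_ hr0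
        rw [key2]
        exact mul_le_mul_of_nonneg_right hsr (abs_nonneg _)
  have hpos := abs_pos.mpr hne
  obtain ⟨N, hN⟩ := exists_nat_gt (1 / |dd α r₀ - dd β r₀|)
  obtain ⟨r, h1, h2⟩ := exists_best_gt ha (max N r₀)
  have h3 := hmono r (by omega) h2
  have h4 := h2.mul_lt_one ha
  have h5 := ((hiff r).1 h2).mul_lt_one hb
  have p1 := dd_pos ha h2.1
  have p2 := dd_pos hb h2.1
  have hr0 : (0 : ℝ) < r := by exact_mod_cast h2.1
  have h6 : (r : ℝ) * |dd α r - dd β r| < 1 := by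
    rw [← Nat.abs_cast r, ← abs_mul, abs_lt]
    constructor <;> nlinarith [mul_pos hr0 p1, mul_pos hr0 p2]
  have hNr : (N : ℝ) < r := by exact_mod_cast (by omega : N < r)
  have h7 := hN.trans hNr
  rw [div_lt_iff₀ hpos] at h7
  nlinarith

/-- Neither of two irrationality measure functions eventually stays above the other. -/
lemma exists_mu_le (ha : Irrational α) (hb : Irrational β) (M : ℕ) :
    ∃ m ≥ M, mu α m ≤ mu β m := by
  by_contra! hcon
  have main : ∀ q q', M ≤ q → Consec α q q' → ∀ s, q < s → s ≤ q' → ¬ IsBest β s := by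
    intro q q' hq h s₀ hs1 hs2 hs3
    have hq1 := h.2.1.1
    have hqq := h.1
    have hsb := lastBest_isBest β (m := q') (by omega)
    have hmq' := hcon q' (by omega)
    have hmq := hcon q hq
    rw [h.2.2.1.mu_eq, mu] at hmq'
    rw [h.2.1.mu_eq] at hmq
    have hle := lastBest_le β q'
    have hge := le_lastBest hs3 hs2
    set s := lastBest β q' with hs
    obtain ⟨s', hs'⟩ := exists_consec hsb (by omega)
    have i1 := h.identity ha
    have i2 := hs'.identity hb
    have hsq : (s : ℝ) ≤ q' := by exact_mod_cast hle
    have hs0 : (0 : ℝ) < s := by exact_mod_cast hsb.1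
    have hs0' : (0 : ℝ) < s' := by exact_mod_cast hs'.2.1.1
    have hq0 : (0 : ℝ) < q := by exact_mod_cast hq1
    have hqq0 : (q : ℝ) < q' := by exact_mod_cast hqq
    have p1 := dd_pos ha hq1
    have p2 := dd_pos ha h.2.2.1.1
    have p3 := dd_pos hb hsb.1
    have p4 := dd_pos hb hs'.2.1.1
    rcases le_or_gt s' q with hc | hc
    · rw [hs'.mu_eq hc (by omega)] at hmq
      have hc' : (s' : ℝ) ≤ q := by exact_mod_cast hc
      have a1 : (s : ℝ) * dd β s' < s * dd α q := mul_lt_mul_of_pos_left hmq hs0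
      have a2 : (s : ℝ) * dd α q ≤ q' * dd α q := mul_le_mul_of_nonneg_right hsq p1.le
      have a3 : (s' : ℝ) * dd β s ≤ q * dd α q' :=
        mul_le_mul hc' hmq'.le p3.le hq0.le
      linarith
    · obtain ⟨r, hr⟩ := exists_consec hs'.2.1 (by omega)
      obtain ⟨A, hA, -, hd⟩ := hr.step hb hs'
      have hss := hs'.1
      have hm := hcon (s' - 1) (by omega)
      rw [hr.mu_pred, h.mu_eq (by omega) (by omega)] at hm
      have hA' : (1 : ℝ) ≤ A := by exact_mod_cast hA
      have b1 : dd β s' + dd β s ≤ dd β r := by rw [hd]; nlinarith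
      have hss' : (s' : ℝ) < s := by exact_mod_cast hss
      have b2 : (q' : ℝ) * (dd β s' + dd β s) < q' * dd α q :=
        mul_lt_mul_of_pos_left (b1.trans_lt hm) (by linarith)
      nlinarith [mul_pos hq0 p2]
  obtain ⟨q, hq, hqb⟩ := exists_best_gt ha M
  obtain ⟨b, hb1, hb2⟩ := exists_best_gt hb q
  obtain ⟨q', h1, h2⟩ := Consec.exists_of_isBest_lt ha (m := b - 1) (by omega)
  have h3 := le_lastBest hqb (by omega : q ≤ b - 1)
  have h4 := lastBest_le α (b - 1)
  exact main _ q' (by omega) h1 b (by omega) (by omega) hb2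

end Pair

/-- The order pattern of a finite family of decreasing step functions.  The linear order on
epoch `i` is `R (cl i)`; `J f i` says that `f` jumps at the beginning of epoch `i`, and
`P f i j` that the beginnings of epochs `i` and `j` are consecutive jumps of `f`. -/
structure JumpSystem {ι C : Type*} [Fintype ι] [Fintype C] (k : ℕ) (R : C → ι → ι → Prop)
    (cl : ℕ → C) (J : ι → ℕ → Prop) (P : ι → ℕ → ℕ → Prop) (M : ℕ) : Prop where
  two_le : 2 ≤ k
  card_index : Fintype.card ι = k * (k + 1) / 2
  card_class : Fintype.card C = k
  asymm : ∀ {c f g}, R c f g → ¬ R c g f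
  trans : ∀ {c f g h}, R c f g → R c g h → R c f h
  total : ∀ {f g}, f ≠ g → ∀ c, R c f g ∨ R c g f
  cl_ne : ∀ i, cl i ≠ cl (i + 1)
  cl_inf : ∀ c N, ∃ i, N ≤ i ∧ cl i = c
  exists_lt : ∀ {f g}, f ≠ g → ∃ c, R c f g
  lt_of_succ : ∀ {i f g}, R (cl (i + 1)) f g → ¬ J f (i + 1) → R (cl i) f g
  P_lt : ∀ {f i j}, P f i j → i < j
  P_left : ∀ {f i j}, P f i j → J f i
  P_between : ∀ {f i j}, P f i j → ∀ e, i < e → e < j → ¬ J f e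
  P_inj : ∀ {f g i j}, P f i j → P g i j → f = g
  swap_prev : ∀ {i f g}, M ≤ i → J f (i + 1) → J g (i + 1) → R (cl i) f g →
    ∃ j, P f (j + 1) (i + 1) ∧ R (cl j) g f ∧ ∀ e, j + 1 ≤ e → e ≤ i → R (cl e) f g
  swap_prev_other : ∀ {i j f g}, M ≤ i → J f (i + 1) → J g (i + 1) → R (cl i) f g →
    R (cl (i + 1)) f g → P f (j + 1) (i + 1) →
    ∃ l, l < j ∧ P g (l + 1) (i + 1) ∧ R (cl l) f g ∧ ∀ e, l + 1 ≤ e → e ≤ j → R (cl e) g f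
  compare : ∀ {i y x a b g g' g''}, i < y → y < x + 1 → x + 1 < a → a < b →
    P g y (x + 1) → P g (x + 1) b → P g' i (x + 1) → P g' (x + 1) a → P g'' y a → P g'' a b →
    R (cl x) g' g

namespace JumpSystem

open scoped Classical

variable {ι C : Type*} [Fintype ι] [Fintype C] {k : ℕ} {R : C → ι → ι → Prop}
    {cl : ℕ → C} {J : ι → ℕ → Prop} {P : ι → ℕ → ℕ → Prop} {M : ℕ}

lemma irrefl (h : JumpSystem k R cl J P M) {c : C} {f : ι} : ¬ R c f f :=
  fun hf => h.asymm hf hf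

lemma not_iff (h : JumpSystem k R cl J P M) {f g : ι} (hfg : f ≠ g) (c : C) :
    ¬ R c f g ↔ R c g f :=
  ⟨fun h1 => (h.total hfg c).resolve_left h1, fun h1 => h.asymm h1⟩

lemma P_unique (h : JumpSystem k R cl J P M) {f : ι} {i i' j : ℕ} (h1 : P f i j)
    (h2 : P f i' j) : i = i' := by
  rcases lt_trichotomy i i' with hlt | heq | hlt
  · exact absurd (h.P_left h2) (h.P_between h1 _ hlt (h.P_lt h2))
  · exact heq
  · exact absurd (h.P_left h1) (h.P_between h2 _ hlt (h.P_lt h1))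

/-- A function that does not jump on `(a, b]` and is smaller at the end was always smaller. -/
lemma lt_of_no_jump (h : JumpSystem k R cl J P M) {f g : ι} {a b : ℕ}
    (hJ : ∀ e, a < e → e ≤ b → ¬ J f e) (hb : R (cl b) f g) :
    ∀ e, a ≤ e → e ≤ b → R (cl e) f g := by
  have key : ∀ d e, a ≤ e → e + d = b → R (cl e) f g := by
    intro d
    induction d with
    | zero => intro e _ he; rw [show e = b by omega]; exact hb
    | succ d ih =>
      intro e hae he
      exact h.lt_of_succ (ih (e + 1) (by omega) (by omega)) (hJ _ (by omega) (by omega))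
  intro e h1 h2
  exact key (b - e) e h1 (by omega)

/-- Along a closed walk on which `f` does not jump, its position relative to any other
function is constant. -/
lemma const_of_no_jump (h : JumpSystem k R cl J P M) {f g : ι} {a b : ℕ}
    (hJ : ∀ e, a < e → e ≤ b → ¬ J f e) (hab : R (cl a) f g → R (cl b) f g) :
    ∀ e, a ≤ e → e ≤ b → (R (cl e) f g ↔ R (cl a) f g) := by
  intro e h1 h2
  refine ⟨fun h3 => ?_, fun h3 => h.lt_of_no_jump hJ (hab h3) e h1 h2⟩
  exact h.lt_of_no_jump (b := e) (fun e' h4 h5 => hJ e' h4 (by omega)) h3 a le_rfl h1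

/-- The functions jumping at the beginning of epoch `i`. -/
noncomputable def jumps (J : ι → ℕ → Prop) (i : ℕ) : Finset ι :=
  Finset.univ.filter fun f => J f i

lemma mem_jumps {f : ι} {i : ℕ} : f ∈ jumps J i ↔ J f i := by simp [jumps]

lemma exists_jump_ge (h : JumpSystem k R cl J P M) (f : ι) (N : ℕ) : ∃ i, N < i ∧ J f i := by
  have hcard : 1 < Fintype.card ι := by
    rw [h.card_index]
    have := h.two_le
    have : 2 * 3 ≤ k * (k + 1) := Nat.mul_le_mul (by omega) (by omega)
    omega
  obtain ⟨g, hg⟩ := Fintype.exists_ne_of_one_lt_card hcard f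
  obtain ⟨c, hc⟩ := h.exists_lt hg
  obtain ⟨c', hc'⟩ := h.exists_lt hg.symm
  obtain ⟨a, ha, rfl⟩ := h.cl_inf c N
  obtain ⟨b, hb, rfl⟩ := h.cl_inf c' a
  by_contra! hcon
  exact h.asymm hc (h.lt_of_no_jump (a := N) (fun e h1 _ => hcon e h1) hc' a ha hb)

lemma exists_prev_ge (h : JumpSystem k R cl J P M) (N : ℕ) :
    ∃ M' ≥ M, ∀ f i j, M' ≤ i → P f j i → N < j := by
  choose b hb1 hb2 using fun f => h.exists_jump_ge f N
  refine ⟨max M (Finset.univ.sup b + 1), le_max_left _ _, fun f i j hi hP => ?_⟩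
  have h1 : b f ≤ Finset.univ.sup b := Finset.le_sup (Finset.mem_univ f)
  have h2 := hb1 f
  by_contra hcon
  exact h.P_between hP (b f) (by omega) (by omega) (hb2 f)

/-- The linear orders of the classes in `Z` coincide on `S`. -/
def AgreeOn (R : C → ι → ι → Prop) (Z : Finset C) (S : Set ι) : Prop :=
  ∀ c ∈ Z, ∀ c' ∈ Z, ∀ f ∈ S, ∀ g ∈ S, R c f g → R c' f g

lemma exists_top (h : JumpSystem k R cl J P M) (c : C) {S : Finset ι} (hS : S.Nonempty) :
    ∃ t ∈ S, ∀ f ∈ S, f ≠ t → R c f t := by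
  induction hS using Finset.Nonempty.cons_induction with
  | singleton a => exact ⟨a, by simp, fun f hf hne => absurd (by simpa using hf) hne⟩
  | cons a s ha _ ih =>
    obtain ⟨t, ht, h1⟩ := ih
    have hat : a ≠ t := by rintro rfl; exact ha ht
    rcases h.total hat c with h2 | h2
    · refine ⟨t, by simp [ht], fun f hf hne => ?_⟩
      rcases Finset.mem_cons.mp hf with rfl | hf
      · exact h2
      · exact h1 f hf hne
    · refine ⟨a, by simp, fun f hf hne => ?_⟩
      rcases Finset.mem_cons.mp hf with rfl | hf
      · exact absurd rfl hne
      · rcases eq_or_ne f t with rfl | h3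
        · exact h2
        · exact h.trans (h1 f hf h3) h2

lemma card_add_card_le (h : JumpSystem k R cl J P M) {i : ℕ} (hi : M ≤ i) {S : Finset ι}
    (hS : ∀ f ∈ S, J f (i + 1)) {Z : Finset C} (hZ : AgreeOn R Z S) :
    S.card + Z.card ≤ k + 1 := by
  rcases S.eq_empty_or_nonempty with rfl | hne
  · have := Z.card_le_univ
    rw [h.card_class] at this
    simp; omega
  obtain ⟨t, ht, htop⟩ := h.exists_top (cl i) hne
  have hex : ∀ f, ∃ j, f ∈ S → f ≠ t → P f (j + 1) (i + 1) ∧ R (cl j) t f ∧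
      ∀ e, j + 1 ≤ e → e ≤ i → R (cl e) f t := by
    intro f
    by_cases hf : f ∈ S ∧ f ≠ t
    · obtain ⟨j, hj⟩ := h.swap_prev hi (hS f hf.1) (hS t ht) (htop f hf.1 hf.2)
      exact ⟨j, fun _ _ => hj⟩
    · exact ⟨0, fun h1 h2 => absurd ⟨h1, h2⟩ hf⟩
  choose j hj using hex
  let e : ι → ℕ := fun f => if f = t then i else j f
  have hdiff : ∀ f ∈ S, ∀ g ∈ S, f ≠ g →
      ∃ a ∈ S, ∃ b ∈ S, R (cl (e f)) a b ∧ R (cl (e g)) b a := by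
    have top_case : ∀ g ∈ S, g ≠ t → R (cl (e t)) g t ∧ R (cl (e g)) t g := fun g hg hgt => by
      simp only [e, if_true, if_neg hgt]
      exact ⟨htop g hg hgt, (hj g hg hgt).2.1⟩
    have lt_case : ∀ f ∈ S, ∀ g ∈ S, f ≠ t → g ≠ t → j f < j g →
        R (cl (e f)) t f ∧ R (cl (e g)) f t := fun f hf g hg hft hgt hlt => by
      simp only [e, if_neg hft, if_neg hgt]
      have := h.P_lt (hj g hg hgt).1
      exact ⟨(hj f hf hft).2.1, (hj f hf hft).2.2 _ (by omega) (by omega)⟩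
    intro f hf g hg hfg
    by_cases hft : f = t
    · subst hft
      exact ⟨g, hg, f, hf, top_case g hg hfg.symm⟩
    by_cases hgt : g = t
    · subst hgt
      exact ⟨g, hg, f, hf, (top_case f hf hft).symm⟩
    rcases lt_trichotomy (j f) (j g) with hlt | heq | hlt
    · exact ⟨t, ht, f, hf, lt_case f hf g hg hft hgt hlt⟩
    · have h1 := (hj f hf hft).1
      rw [heq] at h1
      exact absurd (h.P_inj h1 (hj g hg hgt).1) hfg
    · exact ⟨g, hg, t, ht, (lt_case g hg f hf hgt hft hlt).symm⟩
  have hinj : Set.InjOn (fun f => cl (e f)) S := by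
    intro f hf g hg hfg
    by_contra hne'
    obtain ⟨a, -, b, -, h1, h2⟩ := hdiff f hf g hg hne'
    simp only at hfg
    rw [hfg] at h1
    exact h.asymm h1 h2
  have hA : (S.image fun f => cl (e f)).card = S.card := Finset.card_image_of_injOn hinj
  have hAZ : ((S.image fun f => cl (e f)) ∩ Z).card ≤ 1 := by
    rw [Finset.card_le_one]
    intro a ha b hb
    simp only [Finset.mem_inter, Finset.mem_image] at ha hb
    obtain ⟨⟨f, hf, rfl⟩, hfZ⟩ := ha
    obtain ⟨⟨g, hg, rfl⟩, hgZ⟩ := hb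
    by_contra hne'
    have hfg : f ≠ g := by rintro rfl; exact hne' rfl
    obtain ⟨a, ha, b, hb, h1, h2⟩ := hdiff f hf g hg hfg
    exact h.asymm (hZ _ hfZ _ hgZ a ha b hb h1) h2
  have := Finset.card_union_add_card_inter (S.image fun f => cl (e f)) Z
  have h2 := ((S.image fun f => cl (e f)) ∪ Z).card_le_univ
  rw [h.card_class] at h2
  omega

lemma card_jumps_le (h : JumpSystem k R cl J P M) {i : ℕ} (hi : M ≤ i) :
    (jumps J (i + 1)).card ≤ k := by
  have := h.card_add_card_le hi (S := jumps J (i + 1)) (fun f hf => mem_jumps.mp hf)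
    (Z := {cl i}) (by
      intro c hc c' hc' f _ g _ h1
      rw [Finset.mem_singleton] at hc hc'
      rwa [hc', ← hc])
  simpa using this

lemma AgreeOn.insert_succ (h : JumpSystem k R cl J P M) {i : ℕ} {Z : Finset C} {D : Finset ι}
    (hZ : AgreeOn R Z (Dᶜ : Finset ι)) (hi : cl i ∈ Z) :
    AgreeOn R (insert (cl (i + 1)) Z) ((D ∪ jumps J (i + 1))ᶜ : Finset ι) := by
  have back : ∀ f ∉ D ∪ jumps J (i + 1), ∀ g ∉ D ∪ jumps J (i + 1),
      (R (cl (i + 1)) f g ↔ R (cl i) f g) := by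
    intro f hf g hg
    simp only [Finset.mem_union, mem_jumps, not_or] at hf hg
    refine ⟨fun h1 => h.lt_of_succ h1 hf.2, fun h1 => ?_⟩
    by_contra h2
    have hne : f ≠ g := by rintro rfl; exact h.irrefl h1
    exact h.asymm h1 (h.lt_of_succ ((h.not_iff hne _).1 h2) hg.2)
  intro c hc c' hc' f hf g hg h1
  simp only [Finset.coe_compl, Set.mem_compl_iff, Finset.mem_coe] at hf hg
  have hf' : f ∈ ((Dᶜ : Finset ι) : Set ι) := by
    simp only [Finset.mem_union, not_or] at hf; simpa using hf.1
  have hg' : g ∈ ((Dᶜ : Finset ι) : Set ι) := by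
    simp only [Finset.mem_union, not_or] at hg; simpa using hg.1
  rcases Finset.mem_insert.mp hc with rfl | hc <;> rcases Finset.mem_insert.mp hc' with rfl | hc'
  · exact h1
  · exact hZ _ hi _ hc' f hf' g hg' ((back f hf g hg).1 h1)
  · exact (back f hf g hg).2 (hZ _ hc _ hi f hf' g hg' h1)
  · exact hZ _ hc _ hc' f hf' g hg' h1

lemma AgreeOn.card_sdiff_le (h : JumpSystem k R cl J P M) {i : ℕ} (hi : M ≤ i) {Z : Finset C}
    {D : Finset ι} (hZ : AgreeOn R Z (Dᶜ : Finset ι)) :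
    (D ∪ jumps J (i + 1)).card + Z.card ≤ D.card + (k + 1) := by
  have h1 := h.card_add_card_le hi (S := jumps J (i + 1) \ D) (Z := Z)
    (fun f hf => mem_jumps.mp (Finset.mem_sdiff.mp hf).1)
    (fun c hc c' hc' f hf g hg => hZ c hc c' hc' f
      (by simpa using (Finset.mem_sdiff.mp hf).2) g (by simpa using (Finset.mem_sdiff.mp hg).2))
  have h2 := Finset.card_sdiff_add_card (jumps J (i + 1)) D
  rw [Finset.union_comm] at h2
  omega

/-- The functions jumping at the beginning of one of the `m` epochs after epoch `i`. -/
noncomputable def jumpsUpto (J : ι → ℕ → Prop) (i : ℕ) : ℕ → Finset ι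
  | 0 => ∅
  | m + 1 => jumpsUpto J i m ∪ jumps J (i + m + 1)

lemma mem_jumpsUpto {f : ι} {i m : ℕ} :
    f ∈ jumpsUpto J i m ↔ ∃ e, i < e ∧ e ≤ i + m ∧ J f e := by
  induction m with
  | zero => simp only [jumpsUpto, Finset.notMem_empty, false_iff]; rintro ⟨e, h1, h2, -⟩; omega
  | succ m ih =>
    rw [jumpsUpto, Finset.mem_union, ih, mem_jumps]
    constructor
    · rintro (⟨e, h1, h2, h3⟩ | h3)
      · exact ⟨e, h1, by omega, h3⟩
      · exact ⟨i + m + 1, by omega, by omega, h3⟩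
    · rintro ⟨e, h1, h2, h3⟩
      rcases (by omega : e ≤ i + m ∨ e = i + m + 1) with h4 | rfl
      · exact Or.inl ⟨e, h1, h4, h3⟩
      · exact Or.inr h3

lemma image_Icc_succ {X : Type*} (c : ℕ → X) (i d : ℕ) :
    (Finset.Icc i (i + (d + 1))).image c =
      insert (c (i + d + 1)) ((Finset.Icc i (i + d)).image c) := by
  rw [← Finset.image_insert]
  congr 1
  ext e
  simp only [Finset.mem_Icc, Finset.mem_insert]
  omega

lemma card_jumpsUpto_le (h : JumpSystem k R cl J P M) {i : ℕ} (hi : M ≤ i) (m : ℕ)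
    (hinj : Set.InjOn cl (Finset.Ico i (i + m))) :
    (jumpsUpto J i m).card ≤ ∑ u ∈ Finset.range m, (k - u) := by
  have main : ∀ d ≤ m, (jumpsUpto J i d).card ≤ ∑ u ∈ Finset.range d, (k - u) ∧
      AgreeOn R ((Finset.Icc i (i + d)).image cl) ((jumpsUpto J i d)ᶜ : Finset ι) := by
    intro d
    induction d with
    | zero =>
      refine fun _ => ⟨by simp [jumpsUpto], ?_⟩
      intro c hc c' hc' f _ g _ h1
      simp only [Nat.add_zero, Finset.Icc_self, Finset.image_singleton,
        Finset.mem_singleton] at hc hc'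
      rwa [hc', ← hc]
    | succ d ih =>
      intro hd
      obtain ⟨h1, h2⟩ := ih (by omega)
      have hsub : (Finset.Icc i (i + d) : Set ℕ) ⊆ Finset.Ico i (i + m) := by
        intro e; simp only [Finset.coe_Icc, Finset.coe_Ico, Set.mem_Icc, Set.mem_Ico]; omega
      have hc : ((Finset.Icc i (i + d)).image cl).card = d + 1 := by
        rw [Finset.card_image_of_injOn (hinj.mono hsub), Nat.card_Icc]; omega
      constructor
      · have h3 := h2.card_sdiff_le h (i := i + d) (by omega)
        rw [hc] at h3
        rw [Finset.sum_range_succ, jumpsUpto]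
        omega
      · have h3 := h2.insert_succ h (i := i + d)
          (Finset.mem_image_of_mem _ (Finset.mem_Icc.mpr ⟨by omega, le_rfl⟩))
        rwa [image_Icc_succ]
  exact (main m le_rfl).1

lemma sum_range_sub (k : ℕ) : ∑ u ∈ Finset.range k, (k - u) = k * (k + 1) / 2 := by
  rw [← Finset.sum_range_reflect]
  have : ∑ j ∈ Finset.range k, (k - (k - 1 - j)) = ∑ j ∈ Finset.range k, (j + 1) := by
    apply Finset.sum_congr rfl
    intro j hj
    rw [Finset.mem_range] at hj
    omega
  rw [this]
  have h2 := Finset.sum_range_succ' (fun j => j) k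
  simp only [Nat.add_zero] at h2
  rw [← h2, Finset.sum_range_id, Nat.add_sub_cancel, mul_comm]

lemma card_jumps (h : JumpSystem k R cl J P M) {i : ℕ} (hi : M ≤ i) :
    (jumps J (i + 1)).card = k := by
  refine le_antisymm (h.card_jumps_le hi) ?_
  have hk := h.two_le
  have main : ∀ m, ∃ D : Finset ι,
      AgreeOn R ((Finset.Icc i (i + (m + 1))).image cl) (Dᶜ : Finset ι) ∧
      D.card + k ≤ (jumps J (i + 1)).card +
        ∑ u ∈ Finset.range (((Finset.Icc i (i + (m + 1))).image cl).card - 1), (k - u) := by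
    intro m
    induction m with
    | zero =>
      have hZ : AgreeOn R ({cl i} : Finset C) ((∅ : Finset ι)ᶜ : Finset ι) := by
        intro c hc c' hc' f _ g _ h1
        rw [Finset.mem_singleton] at hc hc'
        rwa [hc', ← hc]
      have e1 : (Finset.Icc i (i + (0 + 1))).image cl = insert (cl (i + 1)) {cl i} := by
        rw [image_Icc_succ]; simp
      refine ⟨∅ ∪ jumps J (i + 1), ?_, ?_⟩
      · rw [e1]; exact hZ.insert_succ h (Finset.mem_singleton_self _)
      · rw [e1, Finset.card_pair (h.cl_ne i).symm]; simp
    | succ m ih =>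
      obtain ⟨D, h1, h2⟩ := ih
      rw [image_Icc_succ]
      by_cases hnew : cl (i + (m + 1) + 1) ∈ (Finset.Icc i (i + (m + 1))).image cl
      · rw [Finset.insert_eq_of_mem hnew]
        exact ⟨D, h1, h2⟩
      · have hmem : cl (i + (m + 1)) ∈ (Finset.Icc i (i + (m + 1))).image cl :=
          Finset.mem_image_of_mem _ (Finset.mem_Icc.mpr ⟨by omega, le_rfl⟩)
        refine ⟨D ∪ jumps J (i + (m + 1) + 1), h1.insert_succ h hmem, ?_⟩
        have h3 := h1.card_sdiff_le h (i := i + (m + 1)) (by omega)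
        have h4 : 0 < ((Finset.Icc i (i + (m + 1))).image cl).card := Finset.card_pos.mpr ⟨_, hmem⟩
        rw [Finset.card_insert_of_notMem hnew]
        obtain ⟨w, hw⟩ : ∃ w, ((Finset.Icc i (i + (m + 1))).image cl).card = w + 1 :=
          ⟨_, (Nat.succ_pred_eq_of_pos h4).symm⟩
        rw [hw] at h2 h3 ⊢
        simp only [Nat.add_sub_cancel] at h2 ⊢
        rw [Finset.sum_range_succ]
        omega
  choose b hb1 hb2 using fun c => h.cl_inf c i
  obtain ⟨D, h1, h2⟩ := main (Finset.univ.sup b)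
  have huniv : (Finset.Icc i (i + (Finset.univ.sup b + 1))).image cl = Finset.univ := by
    rw [Finset.eq_univ_iff_forall]
    intro c
    rw [Finset.mem_image]
    have : b c ≤ Finset.univ.sup b := Finset.le_sup (Finset.mem_univ c)
    exact ⟨b c, Finset.mem_Icc.mpr ⟨hb1 c, by omega⟩, hb2 c⟩
  rw [huniv] at h1 h2
  rw [Finset.card_univ, h.card_class] at h2
  have h3 : (Dᶜ : Finset ι).card ≤ 1 := by
    rw [Finset.card_le_one]
    intro f hf g hg
    by_contra hne
    obtain ⟨c, hc⟩ := h.exists_lt hne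
    obtain ⟨c', hc'⟩ := h.exists_lt (Ne.symm hne)
    exact h.asymm hc' (h1 c (Finset.mem_univ _) c' (Finset.mem_univ _) f hf g hg hc)
  rw [Finset.card_compl, h.card_index, ← sum_range_sub] at h3
  obtain ⟨w, rfl⟩ : ∃ w, k = w + 1 := ⟨k - 1, by omega⟩
  rw [Finset.sum_range_succ] at h3
  simp only [Nat.add_sub_cancel] at h2
  omega

lemma exists_notMem_jumpsUpto (h : JumpSystem k R cl J P M) {i m : ℕ} (hi : M ≤ i) (hm : m < k)
    (hinj : Set.InjOn cl (Finset.Ico i (i + m))) :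
    ∃ f, ∀ e, i < e → e ≤ i + m → ¬ J f e := by
  have h1 := h.card_jumpsUpto_le hi m hinj
  have h2 : ∑ u ∈ Finset.range m, (k - u) < Fintype.card ι := by
    rw [h.card_index, ← sum_range_sub]
    exact Finset.sum_lt_sum_of_subset (Finset.range_subset_range.mpr hm.le)
      (Finset.mem_range.mpr hm) Finset.notMem_range_self (by omega) (by simp)
  obtain ⟨f, hf⟩ := Finset.exists_mem_notMem_of_card_lt_card
    (h1.trans_lt (h2.trans_eq Finset.card_univ.symm))
  refine ⟨f, fun e h3 h4 h5 => hf.2 (mem_jumpsUpto.mpr ⟨e, h3, h4, h5⟩)⟩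

/-- If all classes are visited along closed walks on which some fixed pair cannot change its
order, we get a contradiction. -/
lemma false_of_const (h : JumpSystem k R cl J P M) {f g : ι} (hfg : f ≠ g) (c₀ : C)
    (hc : ∀ c, R c f g ↔ R c₀ f g) : False := by
  obtain ⟨c, h1⟩ := h.exists_lt hfg
  obtain ⟨c', h2⟩ := h.exists_lt hfg.symm
  exact h.asymm h2 ((hc c').2 ((hc c).1 h1))

/-- The shape of the return of the top function when the class walk closes up too early. -/
lemma exists_excursion (h : JumpSystem k R cl J P M) {N i r : ℕ}
    (hN : ∀ f i j, N ≤ i → P f j i → M < j) (hMi : M ≤ i) (hNi : N ≤ i) (hr : 2 ≤ r)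
    (hrk : r < k) (hret : cl i = cl (i + r)) (hinj : Set.InjOn cl (Finset.Ico i (i + r))) :
    ∃ q m, M ≤ q ∧ m < k ∧ Set.InjOn cl (Finset.Ico q (q + m)) ∧
      cl q ∈ (Finset.Ico i (i + r)).image cl ∧ cl (q + m) ∈ (Finset.Ico i (i + r)).image cl ∧
      ∀ c ∉ (Finset.Ico i (i + r)).image cl, ∃ e, q ≤ e ∧ e ≤ q + m ∧ cl e = c := by
  obtain ⟨s, hs⟩ : ∃ s, i + r = s + 1 := ⟨i + r - 1, by omega⟩
  set Z := (Finset.Ico i (i + r)).image cl with hZ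
  have hZcard : Z.card = r := by
    rw [hZ, Finset.card_image_of_injOn hinj, Nat.card_Ico]; omega
  have hMs : M ≤ s := by omega
  have hSc := h.card_jumps hMs
  have hSne : (jumps J (s + 1)).Nonempty := by
    rw [← Finset.card_pos]; omega
  obtain ⟨t, ht, htop⟩ := h.exists_top (cl s) hSne
  set S := jumps J (s + 1) with hS
  have hex : ∀ f, ∃ j, f ∈ S → f ≠ t → P f (j + 1) (s + 1) ∧ R (cl j) t f ∧
      ∀ e, j + 1 ≤ e → e ≤ s → R (cl e) f t := by
    intro f
    by_cases hf : f ∈ S ∧ f ≠ t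
    · obtain ⟨j, hj⟩ := h.swap_prev hMs (mem_jumps.mp hf.1) (mem_jumps.mp ht) (htop f hf.1 hf.2)
      exact ⟨j, fun _ _ => hj⟩
    · exact ⟨0, fun h1 h2 => absurd ⟨h1, h2⟩ hf⟩
  choose p hp using hex
  have hpinj : Set.InjOn p (S.erase t : Finset ι) := by
    intro f hf g hg hfg
    obtain ⟨h1, h2⟩ := Finset.mem_erase.mp hf
    obtain ⟨h3, h4⟩ := Finset.mem_erase.mp hg
    have h5 := (hp f h2 h1).1
    rw [hfg] at h5
    exact h.P_inj h5 (hp g h4 h3).1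
  set A := (S.erase t).filter fun f => p f < i with hA
  have hAmem : ∀ {f}, f ∈ A ↔ f ∈ S ∧ f ≠ t ∧ p f < i := by
    intro f; simp only [hA, Finset.mem_filter, Finset.mem_erase]; tauto
  have hAcard : k - r ≤ A.card := by
    have h1 := Finset.card_filter_add_card_filter_not (s := S.erase t) (fun f => p f < i)
    rw [Finset.card_erase_of_mem ht, hSc, ← hA] at h1
    have h2 : ((S.erase t).filter fun f => ¬ p f < i).card ≤ (Finset.Ico i (i + r - 1)).card := by
      refine Finset.card_le_card_of_injOn p ?_ (hpinj.mono (by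
        intro f hf; exact (Finset.mem_filter.mp hf).1))
      intro f hf
      obtain ⟨hf1, hf2⟩ := Finset.mem_filter.mp hf
      obtain ⟨h3, h4⟩ := Finset.mem_erase.mp hf1
      have := h.P_lt (hp f h4 h3).1
      rw [Finset.coe_Ico, Set.mem_Ico]
      omega
    rw [Nat.card_Ico] at h2
    omega
  -- behaviour of a pair consisting of an element of `A` and a function above it
  have type0 : ∀ f ∈ A, ∀ g ∈ S, R (cl s) f g → ∃ l, l < p f ∧ P g (l + 1) (s + 1) ∧
      R (cl l) f g ∧ (∀ e, l + 1 ≤ e → e ≤ p f → R (cl e) g f) ∧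
      (∀ e, p f + 1 ≤ e → e ≤ s + 1 → R (cl e) f g) := by
    intro f hf g hg hfg
    obtain ⟨hf1, hf2, hf3⟩ := hAmem.mp hf
    obtain ⟨j, hj1, -, hj3⟩ := h.swap_prev hMs (mem_jumps.mp hf1) (mem_jumps.mp hg) hfg
    have hj : j = p f := by
      have := h.P_unique hj1 (hp f hf1 hf2).1
      omega
    subst hj
    have hi := hj3 i (by omega) (by omega)
    rw [hret, hs] at hi
    obtain ⟨l, h1, h2, h3, h4⟩ := h.swap_prev_other hMs (mem_jumps.mp hf1) (mem_jumps.mp hg)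
      hfg hi hj1
    refine ⟨l, h1, h2, h3, h4, fun e h5 h6 => ?_⟩
    rcases (by omega : e ≤ s ∨ e = s + 1) with h7 | rfl
    · exact hj3 e h5 h7
    · exact hi
  have hAne : A.Nonempty := by rw [← Finset.card_pos]; omega
  obtain ⟨f₀, hf₀⟩ := hAne
  obtain ⟨q, -, hq, -⟩ := type0 f₀ hf₀ t ht
    (htop f₀ (hAmem.mp hf₀).1 (hAmem.mp hf₀).2.1)
  have hpt : ∀ f ∈ A, q < p f ∧ R (cl q) f t ∧ (∀ e, q + 1 ≤ e → e ≤ p f → R (cl e) t f) ∧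
      (∀ e, p f + 1 ≤ e → e ≤ s + 1 → R (cl e) f t) := by
    intro f hf
    obtain ⟨l, h1, h2, h3⟩ := type0 f hf t ht (htop f (hAmem.mp hf).1 (hAmem.mp hf).2.1)
    have : l = q := by have := h.P_unique h2 hq; omega
    subst this
    exact ⟨h1, h3⟩
  obtain ⟨fL, hfL, hmax⟩ := Finset.exists_max_image A p ⟨f₀, hf₀⟩
  have hpi : ∀ f ∈ A, p f < i := fun f hf => (hAmem.mp hf).2.2
  have houtZ : ∀ e, q + 1 ≤ e → e ≤ p fL → cl e ∉ Z := by
    intro e h1 h2 hmem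
    obtain ⟨e', he', hee⟩ := Finset.mem_image.mp hmem
    rw [Finset.mem_Ico] at he'
    have h3 := (hpt fL hfL).2.2.1 e h1 h2
    have := hpi fL hfL
    have h4 := (hpt fL hfL).2.2.2 e' (by omega) (by omega)
    rw [hee] at h4
    exact h.asymm h3 h4
  have hclinj : Set.InjOn (fun f => cl (p f)) A := by
    have aux : ∀ f ∈ A, ∀ g ∈ A, p f < p g → cl (p f) ≠ cl (p g) := by
      intro f hf g hg hlt heq
      have h1 := (hpt f hf).2.2.1 (p f) (by have := (hpt f hf).1; omega) le_rfl
      have h2 := (hpt f hf).2.2.2 (p g) (by omega) (by have := hpi g hg; omega)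
      rw [heq] at h1
      exact h.asymm h1 h2
    intro f hf g hg hfg
    rcases lt_trichotomy (p f) (p g) with hlt | heq | hlt
    · exact absurd hfg (aux f hf g hg hlt)
    · exact hpinj (Finset.mem_of_mem_filter _ hf) (Finset.mem_of_mem_filter _ hg) heq
    · exact absurd hfg.symm (aux g hg f hf hlt)
  have himg : A.image (fun f => cl (p f)) = Zᶜ := by
    refine Finset.eq_of_subset_of_card_le ?_ ?_
    · intro c hc
      obtain ⟨f, hf, rfl⟩ := Finset.mem_image.mp hc
      rw [Finset.mem_compl]
      exact houtZ _ (by have := (hpt f hf).1; omega) (hmax f hf)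
    · rw [Finset.card_image_of_injOn hclinj, Finset.card_compl, h.card_class, hZcard]
      exact hAcard
  have hsurj : ∀ c ∉ Z, ∃ f ∈ A, cl (p f) = c := by
    intro c hc
    rw [← Finset.mem_compl, ← himg] at hc
    exact Finset.mem_image.mp hc
  have hp_of : ∀ e, q + 1 ≤ e → e ≤ p fL → ∃ f ∈ A, p f = e := by
    intro e h1 h2
    obtain ⟨f, hf, hfe⟩ := hsurj _ (houtZ e h1 h2)
    refine ⟨f, hf, ?_⟩
    have htf := (hpt f hf).2.2.1 (p f) (by have := (hpt f hf).1; omega) le_rfl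
    have hle : e ≤ p f := by
      by_contra hcon
      have h3 := (hpt f hf).2.2.2 e (by omega) (by have := hpi fL hfL; omega)
      rw [hfe] at htf
      exact h.asymm htf h3
    by_contra hne
    have hlt : e + 1 ≤ p f := by omega
    have hpfL := hmax f hf
    obtain ⟨f', hf', hfe'⟩ := hsurj _ (houtZ (e + 1) (by omega) (by omega))
    have hne' : p f ≠ p f' := by
      intro heq
      rw [← heq, hfe] at hfe'
      exact h.cl_ne e hfe'
    have hpi1 := hpi f hf
    have hpi2 := hpi f' hf'
    rcases hne'.lt_or_gt with hc | hc
    · have h3 := (hpt f hf).2.2.2 (p f') (by omega) (by omega)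
      rw [hfe'] at h3
      exact h.asymm h3 ((hpt f hf).2.2.1 (e + 1) (by omega) hlt)
    · have h3 := (hpt f' hf').2.2.2 (p f) (by omega) (by omega)
      rw [hfe] at h3
      have h4 : p f' < e := by
        by_contra hcon
        exact h.asymm h3 ((hpt f' hf').2.2.1 e h1 (by omega))
      have h5 := (hpt f' hf').2.2.1 (p f') (by have := (hpt f' hf').1; omega) le_rfl
      rw [hfe'] at h5
      exact h.asymm h5 ((hpt f' hf').2.2.2 (e + 1) (by omega) (by omega))
  have hqZ : cl q ∈ Z := by
    by_contra hcon
    obtain ⟨f, hf, hfe⟩ := hsurj _ hcon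
    have h1 := (hpt f hf).2.2.1 (p f) (by have := (hpt f hf).1; omega) le_rfl
    rw [hfe] at h1
    exact h.asymm h1 (hpt f hf).2.1
  have hLZ : cl (p fL + 1) ∈ Z := by
    by_contra hcon
    obtain ⟨f, hf, hfe⟩ := hsurj _ hcon
    have h1 := (hpt f hf).2.2.1 (p f) (by have := (hpt f hf).1; omega) le_rfl
    have h2 := hpi fL hfL
    have h3 := hmax f hf
    have h4 := (hpt f hf).2.2.2 (p fL + 1) (by omega) (by omega)
    rw [hfe] at h1
    exact h.asymm h1 h4
  have hqL := (hpt fL hfL).1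
  have hinj' : Set.InjOn cl (Finset.Icc (q + 1) (p fL)) := by
    intro a ha b hb hab
    rw [Finset.coe_Icc, Set.mem_Icc] at ha hb
    obtain ⟨f, hf, rfl⟩ := hp_of a ha.1 ha.2
    obtain ⟨g, hg, rfl⟩ := hp_of b hb.1 hb.2
    rw [hclinj hf hg hab]
  refine ⟨q, p fL + 1 - q, ?_, ?_, ?_, hqZ, ?_, ?_⟩
  · have := hN _ _ _ (by omega) hq
    omega
  · have h1 : ((Finset.Icc (q + 1) (p fL)).image cl).card ≤ Zᶜ.card := by
      refine Finset.card_le_card ?_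
      intro c hc
      obtain ⟨e, he, rfl⟩ := Finset.mem_image.mp hc
      rw [Finset.mem_Icc] at he
      rw [Finset.mem_compl]
      exact houtZ e he.1 he.2
    rw [Finset.card_image_of_injOn hinj', Nat.card_Icc, Finset.card_compl, h.card_class,
      hZcard] at h1
    omega
  · have aux : ∀ a b, q ≤ a → a < b → b ≤ p fL → cl a ≠ cl b := by
      intro a b h1 h2 h3 heq
      rcases h1.eq_or_lt with rfl | h1
      · rw [heq] at hqZ
        exact houtZ b (by omega) h3 hqZ
      · have := hinj' (by rw [Finset.coe_Icc, Set.mem_Icc]; omega)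
          (by rw [Finset.coe_Icc, Set.mem_Icc]; omega) heq
        omega
    intro a ha b hb hab
    rw [Finset.coe_Ico, Set.mem_Ico] at ha hb
    rcases lt_trichotomy a b with hlt | heq | hlt
    · exact absurd hab (aux a b ha.1 hlt (by omega))
    · exact heq
    · exact absurd hab.symm (aux b a hb.1 hlt (by omega))
  · rwa [show q + (p fL + 1 - q) = p fL + 1 by omega]
  · intro c hc
    obtain ⟨f, hf, rfl⟩ := hsurj c hc
    have h1 := (hpt f hf).1
    have h2 := hmax f hf
    exact ⟨p f, by omega, by omega, rfl⟩

lemma cl_ne_of_lt (h : JumpSystem k R cl J P M) {N : ℕ}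
    (hN : ∀ f i j, N ≤ i → P f j i → M < j) (hMN : M ≤ N) :
    ∀ r, 1 ≤ r → r < k → ∀ i, N ≤ i → cl i ≠ cl (i + r) := by
  intro r
  induction r using Nat.strong_induction_on with
  | _ r ih =>
    intro hr1 hrk i hi heq
    rcases hr1.eq_or_lt with rfl | hr2
    · exact h.cl_ne i heq
    have hinj : Set.InjOn cl (Finset.Ico i (i + r)) := by
      have aux : ∀ a b, i ≤ a → a < b → b < i + r → cl a ≠ cl b := by
        intro a b h1 h2 h3 h4
        refine ih (b - a) (by omega) (by omega) (by omega) a (by omega) ?_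
        rwa [show a + (b - a) = b by omega]
      intro a ha b hb hab
      rw [Finset.coe_Ico, Set.mem_Ico] at ha hb
      rcases lt_trichotomy a b with hlt | heq | hlt
      · exact absurd hab (aux a b ha.1 hlt (by omega))
      · exact heq
      · exact absurd hab.symm (aux b a hb.1 hlt (by omega))
    obtain ⟨f, hf⟩ := h.exists_notMem_jumpsUpto (hMN.trans hi) hrk hinj
    obtain ⟨q, m, hq, hm, hqinj, hqZ, hmZ, hcov⟩ :=
      h.exists_excursion hN (hMN.trans hi) hi hr2 hrk heq hinj
    obtain ⟨g, hg⟩ := h.exists_notMem_jumpsUpto hq hm hqinj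
    have hfZ : ∀ g, ∀ c ∈ (Finset.Ico i (i + r)).image cl, (R c f g ↔ R (cl i) f g) := by
      intro g c hc
      obtain ⟨e, he, rfl⟩ := Finset.mem_image.mp hc
      rw [Finset.mem_Ico] at he
      exact h.const_of_no_jump hf (by rw [heq]; exact id) e he.1 (by omega)
    have main : ∀ g, f ≠ g → (∀ e, q ≤ e → e ≤ q + m → (R (cl e) f g ↔ R (cl q) f g)) →
        False := by
      intro g hfg hexc
      refine h.false_of_const hfg (cl i) fun c => ?_
      by_cases hc : c ∈ (Finset.Ico i (i + r)).image cl
      · exact hfZ g c hc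
      · obtain ⟨e, h1, h2, rfl⟩ := hcov c hc
        rw [hexc e h1 h2, hfZ g _ hqZ]
    have hends : ∀ g, R (cl q) f g ↔ R (cl (q + m)) f g := fun g => by
      rw [hfZ g _ hqZ, hfZ g _ hmZ]
    by_cases hfg : f = g
    · subst hfg
      have hcard : 1 < Fintype.card ι := by
        rw [h.card_index]
        have : 2 * 3 ≤ k * (k + 1) := Nat.mul_le_mul (by omega) (by omega)
        omega
      obtain ⟨g, hg'⟩ := Fintype.exists_ne_of_one_lt_card hcard f
      exact main g hg'.symm (h.const_of_no_jump hg (hends g).1)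
    · refine main g hfg fun e h1 h2 => ?_
      have h3 := h.const_of_no_jump (f := g) (g := f) hg
        (by rw [← h.not_iff hfg, ← h.not_iff hfg, hends g]; exact id) e h1 h2
      rw [← h.not_iff hfg, ← h.not_iff hfg] at h3
      exact not_iff_not.mp h3

/-- Eventually the classes repeat with period `k`, running through all classes. -/
lemma exists_periodic (h : JumpSystem k R cl J P M) : ∃ N ≥ M, ∀ i ≥ N,
    cl (i + k) = cl i ∧ ∀ c, ∃ e, i ≤ e ∧ e < i + k ∧ cl e = c := by
  obtain ⟨N, hMN, hN⟩ := h.exists_prev_ge M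
  refine ⟨N, hMN, fun i hi => ?_⟩
  have hne := h.cl_ne_of_lt hN hMN
  have aux : ∀ a b, i ≤ a → a < b → b < i + k → cl a ≠ cl b := by
    intro a b h1 h2 h3 h4
    refine hne (b - a) (by omega) (by omega) a (by omega) ?_
    rwa [show a + (b - a) = b by omega]
  have hinj : Set.InjOn cl (Finset.Ico i (i + k)) := by
    intro a ha b hb hab
    rw [Finset.coe_Ico, Set.mem_Ico] at ha hb
    rcases lt_trichotomy a b with hlt | heq | hlt
    · exact absurd hab (aux a b ha.1 hlt (by omega))
    · exact heq
    · exact absurd hab.symm (aux b a hb.1 hlt (by omega))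
  have himg : (Finset.Ico i (i + k)).image cl = Finset.univ := by
    apply Finset.eq_univ_of_card
    rw [Finset.card_image_of_injOn hinj, Nat.card_Ico, h.card_class]
    omega
  have hsurj : ∀ c, ∃ e, i ≤ e ∧ e < i + k ∧ cl e = c := by
    intro c
    have hc := Finset.mem_univ c
    rw [← himg] at hc
    obtain ⟨e, he, hec⟩ := Finset.mem_image.mp hc
    rw [Finset.mem_Ico] at he
    exact ⟨e, he.1, he.2, hec⟩
  refine ⟨?_, hsurj⟩
  obtain ⟨e, h1, h2, h3⟩ := hsurj (cl (i + k))
  rcases h1.eq_or_lt with rfl | h1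
  · exact h3.symm
  · refine absurd ?_ (hne (i + k - e) (by omega) (by omega) e (by omega))
    rw [show e + (i + k - e) = i + k by omega]
    exact h3

/-- From epoch `N` on, the classes repeat with period `k`, running through all classes. -/
def Periodic (k : ℕ) (cl : ℕ → C) (N : ℕ) : Prop :=
  ∀ i ≥ N, cl (i + k) = cl i ∧ ∀ c, ∃ e, i ≤ e ∧ e < i + k ∧ cl e = c

lemma exists_swap (h : JumpSystem k R cl J P M) {N : ℕ} (hN : Periodic k cl N) {c : ℕ}
    (hc : N ≤ c) {f g : ι} (hfg : f ≠ g) :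
    ∃ e, c ≤ e ∧ e < c + k ∧ R (cl e) g f ∧ R (cl (e + 1)) f g ∧ J f (e + 1) := by
  by_contra! hcon
  have step : ∀ e, c ≤ e → e < c + k → R (cl e) g f → R (cl (e + 1)) g f := by
    intro e h1 h2 h3
    by_contra h4
    have h5 := (h.not_iff hfg.symm _).1 h4
    refine hcon e h1 h2 h3 h5 ?_
    by_contra h6
    exact h.asymm h3 (h.lt_of_succ h5 h6)
  have walk : ∀ d a, c ≤ a → a + d ≤ c + k → R (cl a) g f → R (cl (a + d)) g f := by
    intro d
    induction d with
    | zero => exact fun a _ _ h3 => h3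
    | succ d ih =>
      intro a h1 h2 h3
      exact step (a + d) (by omega) (by omega) (ih a h1 (by omega) h3)
  obtain ⟨c₁, h1⟩ := h.exists_lt hfg.symm
  obtain ⟨c₂, h2⟩ := h.exists_lt hfg
  obtain ⟨e₁, a1, a2, rfl⟩ := (hN c hc).2 c₁
  obtain ⟨e₂, b1, b2, rfl⟩ := (hN c hc).2 c₂
  have h3 := walk (c + k - e₁) e₁ a1 (by omega) h1
  rw [show e₁ + (c + k - e₁) = c + k by omega, (hN c hc).1] at h3
  have h4 := walk (e₂ - c) c le_rfl (by omega) h3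
  rw [show c + (e₂ - c) = e₂ by omega] at h4
  exact h.asymm h2 h4

/-- The jumps of `f` during one period. -/
noncomputable def window (k : ℕ) (J : ι → ℕ → Prop) (c : ℕ) (f : ι) : Finset ℕ :=
  (Finset.Ioc c (c + k)).filter (J f)

lemma mem_window {X : Type*} {J : X → ℕ → Prop} {c e : ℕ} {f : X} :
    e ∈ window k J c f ↔ c < e ∧ e ≤ c + k ∧ J f e := by
  simp [window, and_assoc]

lemma window_nonempty (h : JumpSystem k R cl J P M) {N : ℕ} (hN : Periodic k cl N) {c : ℕ}
    (hc : N ≤ c) (f : ι) : (window k J c f).Nonempty := by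
  have hcard : 1 < Fintype.card ι := by
    rw [h.card_index]
    have := h.two_le
    have : 2 * 3 ≤ k * (k + 1) := Nat.mul_le_mul (by omega) (by omega)
    omega
  obtain ⟨g, hg⟩ := Fintype.exists_ne_of_one_lt_card hcard f
  obtain ⟨e, h1, h2, -, -, h3⟩ := h.exists_swap hN hc hg.symm
  exact ⟨e + 1, mem_window.mpr ⟨by omega, by omega, h3⟩⟩

lemma exists_swap_of_window (h : JumpSystem k R cl J P M) {N : ℕ} (hN : Periodic k cl N) {c x : ℕ}
    (hc : N ≤ c) {f g : ι} (hfg : f ≠ g) (hf : window k J c f = {x + 1}) :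
    R (cl x) g f ∧ R (cl (x + 1)) f g := by
  obtain ⟨e, h1, h2, h3, h4, h5⟩ := h.exists_swap hN hc hfg
  have h6 : e + 1 ∈ window k J c f := mem_window.mpr ⟨by omega, by omega, h5⟩
  rw [hf, Finset.mem_singleton] at h6
  obtain rfl : e = x := by omega
  exact ⟨h3, h4⟩

lemma exists_eq_succ_of_window {X : Type*} {J : X → ℕ → Prop} {c x : ℕ} {f : X}
    (hf : window k J c f = {x}) :
    ∃ y, x = y + 1 ∧ c ≤ y ∧ y < c + k := by
  have hx : x ∈ window k J c f := by rw [hf]; exact Finset.mem_singleton_self x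
  obtain ⟨h1, h2, -⟩ := mem_window.mp hx
  exact ⟨x - 1, by omega, by omega, by omega⟩

lemma eq_of_window_eq_singleton (h : JumpSystem k R cl J P M) {N : ℕ} (hN : Periodic k cl N)
    {c x : ℕ} (hc : N ≤ c) {f g : ι} (hf : window k J c f = {x}) (hg : window k J c g = {x}) :
    f = g := by
  by_contra hfg
  obtain ⟨y, rfl, -, -⟩ := exists_eq_succ_of_window hf
  exact h.asymm (h.exists_swap_of_window hN hc hfg hf).1
    (h.exists_swap_of_window hN hc (Ne.symm hfg) hg).1

/-- In each period every epoch start is the unique jump of exactly one function, and all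
other functions jump exactly twice. -/
lemma window_structure (h : JumpSystem k R cl J P M) {N : ℕ} (hMN : M ≤ N)
    (hN : Periodic k cl N) {c : ℕ} (hc : N ≤ c) :
    (∀ x, c < x → x ≤ c + k → ∃ f, window k J c f = {x}) ∧
      ∀ f, (window k J c f).card ≤ 2 := by
  set S := (Finset.univ : Finset ι).filter fun f => (window k J c f).card = 1 with hS
  have hmemS : ∀ {f}, f ∈ S ↔ ∃ x, window k J c f = {x} := by
    intro f; simp [hS, Finset.card_eq_one]
  choose! x hx using fun f (hf : f ∈ S) => hmemS.mp hf
  have hxinj : Set.InjOn x S := by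
    intro f hf g hg hfg
    have h1 := hx f hf
    rw [hfg] at h1
    exact h.eq_of_window_eq_singleton hN hc h1 (hx g hg)
  have hxsub : S.image x ⊆ Finset.Ioc c (c + k) := by
    intro y hy
    obtain ⟨f, hf, rfl⟩ := Finset.mem_image.mp hy
    have h1 : x f ∈ window k J c f := by rw [hx f hf]; exact Finset.mem_singleton_self _
    obtain ⟨h2, h3, -⟩ := mem_window.mp h1
    exact Finset.mem_Ioc.mpr ⟨h2, h3⟩
  have hSle : S.card ≤ k := by
    have := Finset.card_le_card hxsub
    rw [Finset.card_image_of_injOn hxinj, Nat.card_Ioc] at this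
    omega
  have hsum : ∑ f : ι, (window k J c f).card = k * k := by
    have h1 := Finset.sum_card_bipartiteAbove_eq_sum_card_bipartiteBelow
      (s := (Finset.univ : Finset ι)) (t := Finset.Ioc c (c + k)) J
    have h2 : ∑ b ∈ Finset.Ioc c (c + k), ((Finset.univ : Finset ι).bipartiteBelow J b).card
        = ∑ b ∈ Finset.Ioc c (c + k), k := by
      refine Finset.sum_congr rfl fun b hb => ?_
      rw [Finset.mem_Ioc] at hb
      have h3 := h.card_jumps (i := b - 1) (by omega)
      rw [show b - 1 + 1 = b by omega] at h3
      exact h3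
    rw [h2, Finset.sum_const, Nat.card_Ioc, smul_eq_mul, Nat.add_sub_cancel_left] at h1
    exact h1
  have hle : ∀ f ∈ (Finset.univ : Finset ι), 2 ≤ (window k J c f).card +
      if (window k J c f).card = 1 then 1 else 0 := by
    intro f _
    have := Finset.card_pos.mpr (h.window_nonempty hN hc f)
    split_ifs <;> omega
  have hs2 : ∑ f : ι, ((window k J c f).card +
      if (window k J c f).card = 1 then 1 else 0) = k * k + S.card := by
    rw [Finset.sum_add_distrib, hsum, hS, Finset.card_filter]
  have hs1 : ∑ _f : ι, 2 = k * k + k := by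
    rw [Finset.sum_const, Finset.card_univ, h.card_index, smul_eq_mul,
      Nat.div_mul_cancel (Nat.even_mul_succ_self k).two_dvd]
    ring
  have hle' := Finset.sum_le_sum hle
  rw [hs1, hs2] at hle'
  have hSk : S.card = k := by omega
  have heq := (Finset.sum_eq_sum_iff_of_le hle).1 (by rw [hs1, hs2, hSk])
  constructor
  · intro y h1 h2
    have himg : S.image x = Finset.Ioc c (c + k) := by
      refine Finset.eq_of_subset_of_card_le hxsub ?_
      rw [Finset.card_image_of_injOn hxinj, Nat.card_Ioc, hSk]
      omega
    have hy := Finset.mem_Ioc.mpr ⟨h1, h2⟩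
    rw [← himg] at hy
    obtain ⟨f, hf, rfl⟩ := Finset.mem_image.mp hy
    exact ⟨f, hx f hf⟩
  · intro f
    have := heq f (Finset.mem_univ f)
    omega

lemma window_succ_of_singleton (h : JumpSystem k R cl J P M) {N : ℕ} (hMN : M ≤ N)
    (hN : Periodic k cl N) {c x : ℕ} (hc : N ≤ c) {f : ι} (hf : window k J c f = {x}) :
    window k J (c + 1) f = {if x = c + 1 then c + 1 + k else x} := by
  have hJ : ∀ e, c < e → e ≤ c + k → J f e → e = x := fun e h1 h2 h3 => by
    have h4 : e ∈ window k J c f := mem_window.mpr ⟨h1, h2, h3⟩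
    rwa [hf, Finset.mem_singleton] at h4
  have hx : x ∈ window k J c f := by rw [hf]; exact Finset.mem_singleton_self x
  obtain ⟨hx1, hx2, hx3⟩ := mem_window.mp hx
  have hne := h.window_nonempty hN (by omega : N ≤ c + 1) f
  split_ifs with hxc
  · refine hne.subset_singleton_iff.mp fun e he => ?_
    obtain ⟨h1, h2, h3⟩ := mem_window.mp he
    rw [Finset.mem_singleton]
    by_contra h4
    have := hJ e (by omega) (by omega) h3
    omega
  · refine hne.subset_singleton_iff.mp fun e he => ?_
    obtain ⟨h1, h2, h3⟩ := mem_window.mp he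
    rw [Finset.mem_singleton]
    by_contra h4
    have he' : e = c + 1 + k := by
      by_contra h5
      exact h4 (hJ e (by omega) (by omega) h3)
    obtain ⟨g, hg⟩ := (h.window_structure hMN hN (by omega : N ≤ c + 1)).1 x (by omega) (by omega)
    have hfg : f ≠ g := by
      rintro rfl
      rw [hg, Finset.mem_singleton] at he
      exact h4 he
    obtain ⟨y, rfl, -, -⟩ := exists_eq_succ_of_window hf
    exact h.asymm (h.exists_swap_of_window hN hc hfg hf).1
      (h.exists_swap_of_window hN (by omega : N ≤ c + 1) hfg.symm hg).1

lemma card_window_succ (h : JumpSystem k R cl J P M) {N : ℕ} (hMN : M ≤ N)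
    (hN : Periodic k cl N) {c : ℕ} (hc : N ≤ c) (f : ι) :
    (window k J (c + 1) f).card = (window k J c f).card := by
  have hk := h.two_le
  have p1 := Finset.card_pos.mpr (h.window_nonempty hN hc f)
  have p2 := Finset.card_pos.mpr (h.window_nonempty hN (by omega : N ≤ c + 1) f)
  have q1 := (h.window_structure hMN hN hc).2 f
  have q2 := (h.window_structure hMN hN (by omega : N ≤ c + 1)).2 f
  by_cases h1 : (window k J c f).card = 1
  · obtain ⟨x, hx⟩ := Finset.card_eq_one.mp h1
    rw [h1, h.window_succ_of_singleton hMN hN hc hx, Finset.card_singleton]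
  · by_cases h2 : (window k J (c + 1) f).card = 1
    · exfalso
      obtain ⟨x, hx⟩ := Finset.card_eq_one.mp h2
      obtain ⟨y, rfl, hy1, hy2⟩ := exists_eq_succ_of_window hx
      obtain ⟨g, hg⟩ := (h.window_structure hMN hN hc).1
        (if y = c + k then c + 1 else y + 1) (by split_ifs <;> omega) (by split_ifs <;> omega)
      have hg' := h.window_succ_of_singleton hMN hN hc hg
      have hval : (if (if y = c + k then c + 1 else y + 1) = c + 1 then c + 1 + k
          else (if y = c + k then c + 1 else y + 1)) = y + 1 := by split_ifs <;> omega
      rw [hval] at hg'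
      have := h.eq_of_window_eq_singleton hN (by omega : N ≤ c + 1) hx hg'
      rw [this, hg, Finset.card_singleton] at h1
      exact h1 rfl
    · omega

lemma jump_add_period (h : JumpSystem k R cl J P M) {N : ℕ} (hMN : M ≤ N)
    (hN : Periodic k cl N) {e : ℕ} (he : N < e) (f : ι) : J f (e + k) ↔ J f e := by
  have hk := h.two_le
  obtain ⟨c, rfl⟩ : ∃ c, e = c + 1 := ⟨e - 1, by omega⟩
  have hcard := h.card_window_succ hMN hN (by omega : N ≤ c) f
  have e1 : Finset.Ioc c (c + k) = insert (c + 1) (Finset.Ioc (c + 1) (c + k)) := by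
    ext e; simp only [Finset.mem_Ioc, Finset.mem_insert]; omega
  have e2 : Finset.Ioc (c + 1) (c + 1 + k) = insert (c + 1 + k) (Finset.Ioc (c + 1) (c + k)) := by
    ext e; simp only [Finset.mem_Ioc, Finset.mem_insert]; omega
  rw [window, window, e1, e2, Finset.filter_insert, Finset.filter_insert] at hcard
  have n1 : c + 1 ∉ (Finset.Ioc (c + 1) (c + k)).filter (J f) := by simp
  have n2 : c + 1 + k ∉ (Finset.Ioc (c + 1) (c + k)).filter (J f) := by
    simp only [Finset.mem_filter, Finset.mem_Ioc]; omega
  split_ifs at hcard with h1 h2 h2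
  · exact iff_of_true h1 h2
  · rw [Finset.card_insert_of_notMem n2] at hcard; omega
  · rw [Finset.card_insert_of_notMem n1] at hcard; omega
  · exact iff_of_false h1 h2

/-- `f` is the function jumping, from epoch `N` on, exactly at the epochs congruent to `x`. -/
lemma exists_diagonal (h : JumpSystem k R cl J P M) {N : ℕ} (hMN : M ≤ N)
    (hN : Periodic k cl N) {x : ℕ} (hx : N < x) (hxk : x ≤ N + k) :
    ∃ f, window k J N f = {x} :=
  (h.window_structure hMN hN le_rfl).1 x hx hxk

lemma prev_of_jumps (h : JumpSystem k R cl J P M) {a b : ℕ} {f g : ι}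
    (hMb : M ≤ b) (hab : a < b + 1) (hfa : J f a) (hfb : J f (b + 1)) (hgb : J g (b + 1))
    (hfg : R (cl b) f g) (hbetween : ∀ e, a < e → e < b + 1 → ¬ J f e) : P f a (b + 1) := by
  obtain ⟨j, hj, -⟩ := h.swap_prev hMb hfb hgb hfg
  have h1 := h.P_lt hj
  rcases lt_trichotomy a (j + 1) with hlt | heq | hlt
  · exact absurd (h.P_left hj) (hbetween _ hlt h1)
  · rwa [heq]
  · exact absurd hfa (h.P_between hj a hlt hab)

lemma jump_iff_of_window {X : Type*} {J : X → ℕ → Prop} {c e : ℕ} {f : X} {W : Finset ℕ}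
    (hf : window k J c f = W) (h1 : c < e) (h2 : e ≤ c + k) : J f e ↔ e ∈ W := by
  rw [← hf, mem_window]
  exact ⟨fun h3 => ⟨h1, h2, h3⟩, fun h3 => h3.2.2⟩

/-- Consecutive jumps of a function with two jumps per period. -/
lemma prev_of_window_pair (h : JumpSystem k R cl J P M) {N : ℕ} (hMN : M ≤ N)
    (hN : Periodic k cl N) {a b : ℕ} {f : ι} (hab : a < b) (hf : window k J N f = {a, b}) :
    P f b (a + k) ∧ P f (a + k) (b + k) := by
  have ha := (mem_window (J := J) (f := f) (c := N) (k := k) (e := a)).1 (by rw [hf]; simp)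
  have hb := (mem_window (J := J) (f := f) (c := N) (k := k) (e := b)).1 (by rw [hf]; simp)
  have hper := fun e (he : N < e) => h.jump_add_period hMN hN he f
  have hlow : ∀ e, N < e → e ≤ N + k → J f e → e = a ∨ e = b := fun e h1 h2 h3 => by
    have := (jump_iff_of_window hf h1 h2).1 h3
    simpa using this
  have hhigh : ∀ e, N + k < e → e ≤ N + k + k → J f e → e = a + k ∨ e = b + k :=
    fun e h1 h2 h3 => by
      have h4 := hper (e - k) (by omega)
      rw [show e - k + k = e by omega] at h4
      have := hlow (e - k) (by omega) (by omega) (h4.1 h3)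
      omega
  have below : ∀ x, N < x → x ≤ N + k → (x = a ∨ x = b) →
      ∃ D, J D (x + k) ∧ R (cl (x + k - 1)) f D := by
    intro x h1 h2 h3
    obtain ⟨D, hD⟩ := h.exists_diagonal hMN hN h1 h2
    have hDf : D ≠ f := by
      rintro rfl
      rw [hD] at hf
      have hca := Finset.card_pair hab.ne
      rw [← hf, Finset.card_singleton] at hca
      omega
    obtain ⟨y, rfl, h4, h5⟩ := exists_eq_succ_of_window hD
    refine ⟨D, (h.jump_add_period hMN hN h1 D).2 ((jump_iff_of_window hD h1 h2).2 (by simp)), ?_⟩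
    rw [show y + 1 + k - 1 = y + k by omega, (hN y h4).1]
    exact (h.exists_swap_of_window hN le_rfl hDf hD).1
  obtain ⟨Da, hDa1, hDa2⟩ := below a ha.1 ha.2.1 (Or.inl rfl)
  obtain ⟨Db, hDb1, hDb2⟩ := below b hb.1 hb.2.1 (Or.inr rfl)
  have ja := (hper a ha.1).2 ha.2.2
  have jb := (hper b hb.1).2 hb.2.2
  constructor
  · obtain ⟨x, hx⟩ : ∃ x, a + k = x + 1 := ⟨a + k - 1, by omega⟩
    rw [hx] at ja hDa1 hDa2 ⊢
    refine h.prev_of_jumps (g := Da) (by omega) (by omega) hb.2.2 ja hDa1 hDa2 fun e h1 h2 h3 => ?_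
    rcases (by omega : e ≤ N + k ∨ N + k < e) with h4 | h4
    · have := hlow e (by omega) h4 h3; omega
    · have := hhigh e h4 (by omega) h3; omega
  · obtain ⟨x, hx⟩ : ∃ x, b + k = x + 1 := ⟨b + k - 1, by omega⟩
    rw [hx] at jb hDb1 hDb2 ⊢
    refine h.prev_of_jumps (g := Db) (by omega) (by omega) ja jb hDb1 hDb2 fun e h1 h2 h3 => ?_
    have := hhigh e (by omega) (by omega) h3
    omega

lemma window_eq_pair (h : JumpSystem k R cl J P M) {N : ℕ} (hMN : M ≤ N)
    (hN : Periodic k cl N) {a b : ℕ} {f : ι} (hab : a ≠ b) (ha : a ∈ window k J N f)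
    (hb : b ∈ window k J N f) : window k J N f = {a, b} := by
  symm
  apply Finset.eq_of_subset_of_card_le
  · intro e he
    rcases Finset.mem_insert.mp he with rfl | he
    · exact ha
    · rwa [Finset.mem_singleton.mp he]
  · rw [Finset.card_pair hab]
    exact (h.window_structure hMN hN le_rfl).2 f

lemma eq_of_window_eq (h : JumpSystem k R cl J P M) {N : ℕ} (hMN : M ≤ N)
    (hN : Periodic k cl N) {f g : ι} (hfg : window k J N f = window k J N g) : f = g := by
  have hne := h.window_nonempty hN le_rfl f
  rcases (Finset.min'_le_max' _ hne).eq_or_lt with heq | hlt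
  · have hsing : window k J N f = {(window k J N f).min' hne} := by
      refine hne.subset_singleton_iff.mp fun e he => ?_
      have h1 := Finset.min'_le _ e he
      have h2 := Finset.le_max' _ e he
      rw [Finset.mem_singleton]
      omega
    exact h.eq_of_window_eq_singleton hN le_rfl hsing (hfg ▸ hsing)
  · have hpair := h.window_eq_pair hMN hN hlt.ne (Finset.min'_mem _ hne) (Finset.max'_mem _ hne)
    exact h.P_inj (h.prev_of_window_pair hMN hN hlt hpair).1
      (h.prev_of_window_pair hMN hN hlt (hfg ▸ hpair)).1

/-- The first and last jump of `f` in the period following `N`, counted from `N`. -/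
lemma exists_first_last (h : JumpSystem k R cl J P M) {N : ℕ} (hMN : M ≤ N)
    (hN : Periodic k cl N) (f : ι) : ∃ p : PairIdx k,
      window k J N f = {N + 1 + p.1.1, N + 1 + p.1.2} := by
  have hne := h.window_nonempty hN le_rfl f
  obtain ⟨a1, a2, a3⟩ := mem_window.mp (Finset.min'_mem _ hne)
  obtain ⟨b1, b2, b3⟩ := mem_window.mp (Finset.max'_mem _ hne)
  have hle := Finset.min'_le_max' _ hne
  refine ⟨⟨(⟨(window k J N f).min' hne - (N + 1), by omega⟩,
    ⟨(window k J N f).max' hne - (N + 1), by omega⟩), Fin.mk_le_mk.mpr (by omega)⟩, ?_⟩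
  simp only
  rw [show N + 1 + ((window k J N f).min' hne - (N + 1)) = (window k J N f).min' hne by omega,
    show N + 1 + ((window k J N f).max' hne - (N + 1)) = (window k J N f).max' hne by omega]
  rcases hle.eq_or_lt with heq | hlt
  · rw [← heq, Finset.pair_eq_singleton]
    refine hne.subset_singleton_iff.mp fun e he => ?_
    have h1 := Finset.min'_le _ e he
    have h2 := Finset.le_max' _ e he
    rw [Finset.mem_singleton]
    omega
  · exact h.window_eq_pair hMN hN hlt.ne (Finset.min'_mem _ hne) (Finset.max'_mem _ hne)

/-- Functions correspond to pairs of positions in a period. -/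
lemma exists_equiv (h : JumpSystem k R cl J P M) {N : ℕ} (hMN : M ≤ N) (hN : Periodic k cl N)
    (e : PairIdx k ≃ ι) : ∃ φ : ι ≃ PairIdx k,
      ∀ f, window k J N f = {N + 1 + ((φ f).1.1 : ℕ), N + 1 + ((φ f).1.2 : ℕ)} := by
  choose φ hφ using h.exists_first_last hMN hN
  have hinj : Function.Injective φ := fun f g hfg =>
    h.eq_of_window_eq hMN hN (by rw [hφ f, hφ g, hfg])
  have hsurj : Function.Surjective φ := fun p => by
    have hs : Function.Surjective (e ∘ φ) :=
      Finite.surjective_of_injective (e.injective.comp hinj)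
    obtain ⟨f, hf⟩ := hs (e p)
    exact ⟨f, e.injective hf⟩
  exact ⟨Equiv.ofBijective φ ⟨hinj, hsurj⟩, hφ⟩

/-- The functions below the function jumping only at epoch `i` are those which jump before. -/
lemma lt_diagonal_iff (h : JumpSystem k R cl J P M) {N : ℕ} (hMN : M ≤ N)
    (hN : Periodic k cl N) (e : PairIdx k ≃ ι) {i : ℕ} {D g : ι} (hD : window k J N D = {i})
    (hg : D ≠ g) : R (cl N) D g ↔ ∃ x, N < x ∧ x < i ∧ J g x := by
  have hi := (mem_window (J := J) (f := D) (c := N) (k := k) (e := i)).1 (by rw [hD]; simp)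
  obtain ⟨s, hs, hs1, hs2⟩ := exists_eq_succ_of_window hD
  constructor
  · intro h1
    by_contra! hcon
    have h2 := (h.exists_swap_of_window hN le_rfl hg (hs ▸ hD)).1
    exact h.asymm h1 (h.lt_of_no_jump (a := N) (fun e h3 h4 => hcon e h3 (by omega)) h2 N le_rfl
      (by omega))
  · intro hex
    obtain ⟨hx1, hx2, hx3⟩ := Nat.find_spec hex
    have hmin : ∀ e, N < e → e < Nat.find hex → ¬ J g e := fun e h1 h2 h3 =>
      Nat.find_min hex h2 ⟨h1, by omega, h3⟩
    set x := Nat.find hex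
    -- if `g` has no jumps after `i`
    have early : ∀ g, D ≠ g → (∀ e, N < e → e < x → ¬ J g e) →
        (∀ e, i < e → e ≤ N + k → ¬ J g e) → R (cl (x - 1)) D g := by
      intro g hg hmin hlate
      have h1 := (h.exists_swap_of_window hN le_rfl hg (hs ▸ hD)).2
      rw [← hs] at h1
      rw [← (hN (x - 1) (by omega)).1]
      by_contra h2
      refine h.asymm h1 (h.lt_of_no_jump (a := i) (fun e h3 h4 h5 => ?_)
        ((h.not_iff hg _).1 h2) i le_rfl (by omega))
      rcases (by omega : e ≤ N + k ∨ N + k < e) with h6 | h6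
      · exact hlate e h3 h6 h5
      · have h7 := h.jump_add_period hMN hN (e := e - k) (by omega) g
        rw [show e - k + k = e by omega] at h7
        exact hmin (e - k) (by omega) (by omega) (h7.1 h5)
    refine h.lt_of_no_jump (a := N) (b := x - 1) (fun e h3 h4 h5 => ?_) ?_ N le_rfl (by omega)
    · have := (jump_iff_of_window hD h3 (by omega)).1 h5
      rw [Finset.mem_singleton] at this
      omega
    by_cases hlate : ∀ e, i < e → e ≤ N + k → ¬ J g e
    · exact early g hg hmin hlate
    push Not at hlate
    obtain ⟨y, hy1, hy2, hy3⟩ := hlate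
    have hgw := h.window_eq_pair hMN hN (by omega : x ≠ y)
      (mem_window.mpr ⟨hx1, by omega, hx3⟩) (mem_window.mpr ⟨by omega, hy2, hy3⟩)
    obtain ⟨φ, hφ⟩ := h.exists_equiv hMN hN e
    have hpair : ∀ a b, N < a → a < b → b ≤ N + k → ∃ f, window k J N f = {a, b} := by
      intro a b h1 h2 h3
      refine ⟨φ.symm (mkPos (a - (N + 1)) (b - (N + 1)) (by omega) (by omega)), ?_⟩
      rw [hφ, Equiv.apply_symm_apply]
      simp only [mkPos]
      rw [show N + 1 + (a - (N + 1)) = a by omega, show N + 1 + (b - (N + 1)) = b by omega]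
    obtain ⟨g', hg'⟩ := hpair x i hx1 hx2 hi.2.1
    obtain ⟨g'', hg''⟩ := hpair i y hi.1 hy1 hy2
    have hD' : D ≠ g' := by
      rintro rfl
      have hca := Finset.card_pair hx2.ne
      rw [← hg', hD, Finset.card_singleton] at hca
      omega
    have k1 := early g' hD' (fun e h1 h2 h3 => by
        have := (jump_iff_of_window hg' h1 (by omega)).1 h3
        simp only [Finset.mem_insert, Finset.mem_singleton] at this
        omega) (fun e h1 h2 h3 => by
        have := (jump_iff_of_window hg' (by omega) h2).1 h3
        simp only [Finset.mem_insert, Finset.mem_singleton] at this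
        omega)
    refine h.trans k1 ?_
    rw [← (hN (x - 1) (by omega)).1]
    obtain ⟨p1, p2⟩ := h.prev_of_window_pair hMN hN (by omega) hgw
    obtain ⟨p3, p4⟩ := h.prev_of_window_pair hMN hN hx2 hg'
    obtain ⟨p5, p6⟩ := h.prev_of_window_pair hMN hN hy1 hg''
    have hxk : x + k = x - 1 + k + 1 := by omega
    rw [hxk] at p1 p2 p3 p4
    exact h.compare hy1 (by omega) (by omega) (by omega) p1 p2 p3 p4 p5 p6

end JumpSystem

lemma posIdx_mkPos_diag {k i : ℕ} (hi : i < k) :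
    posIdx (mkPos i i le_rfl hi) = i * k - i * (i - 1) / 2 := by
  simp [posIdx, mkPos]

lemma posIdx_row_succ {k a : ℕ} (ha : a < k) :
    (a + 1) * k - (a + 1) * (a + 1 - 1) / 2 = (a * k - a * (a - 1) / 2) + (k - a) := by
  have h1 := Nat.triangle_succ a
  have h2 : a * (a - 1) / 2 ≤ a * k :=
    (Nat.div_le_self _ _).trans (Nat.mul_le_mul le_rfl (by omega))
  rw [h1, add_mul, one_mul]
  omega

lemma posIdx_row_mono {k a b : ℕ} (hab : a ≤ b) (hb : b ≤ k) :
    a * k - a * (a - 1) / 2 ≤ b * k - b * (b - 1) / 2 := by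
  induction b, hab using Nat.le_induction with
  | base => exact le_rfl
  | succ b _ ih =>
    rw [posIdx_row_succ (by omega)]
    exact (ih (by omega)).trans (by omega)

/-- The positions before `(i, i)` are those with smaller first component. -/
lemma posIdx_lt_diag {k i : ℕ} (hi : i < k) {q : PairIdx k} (hq : (q.1.1 : ℕ) < i) :
    posIdx q < posIdx (mkPos i i le_rfl hi) := by
  have h1 : (q.1.1 : ℕ) ≤ q.1.2 := q.2
  have h2 := q.1.2.isLt
  rw [posIdx_mkPos_diag]
  refine lt_of_lt_of_le ?_ (posIdx_row_mono (a := q.1.1 + 1) hq hi.le)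
  rw [posIdx_row_succ (by omega), posIdx]
  split_ifs <;> omega

lemma diag_lt_posIdx {k i : ℕ} (hi : i < k) {q : PairIdx k} (hq : i ≤ (q.1.1 : ℕ))
    (hne : q ≠ mkPos i i le_rfl hi) : posIdx (mkPos i i le_rfl hi) < posIdx q := by
  have h1 : (q.1.1 : ℕ) ≤ q.1.2 := q.2
  have h2 := q.1.2.isLt
  rw [posIdx_mkPos_diag, posIdx]
  rcases hq.eq_or_lt with heq | hlt
  · split_ifs with h3
    · exact absurd (Subtype.ext (Prod.ext (Fin.ext heq.symm) (Fin.ext (h3.trans heq.symm)))) hne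
    · rw [← heq]
      omega
  · have h3 := posIdx_row_mono (k := k) (a := i + 1) (b := q.1.1) hlt (by omega)
    rw [posIdx_row_succ hi] at h3
    omega

/-- If the order at epoch `N` is the one prescribed by the enumeration of pairs, then the
functions at the diagonal positions jump exactly once per period. -/
lemma JumpSystem.diagonal_jump_iff {ι C : Type*} [Fintype ι] [Fintype C] {k : ℕ}
    {R : C → ι → ι → Prop} {cl : ℕ → C} {J : ι → ℕ → Prop} {P : ι → ℕ → ℕ → Prop} {M : ℕ}
    (h : JumpSystem k R cl J P M) {N : ℕ} (hMN : M ≤ N) (hN : JumpSystem.Periodic k cl N)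
    (e : PairIdx k ≃ ι) (he : ∀ p q, posIdx p < posIdx q → R (cl N) (e q) (e p))
    {i : ℕ} (hi : i < k) {j : ℕ} (hj : 1 ≤ j) :
    J (e (mkPos i i le_rfl hi)) (N + j) ↔ ∃ s, j = i + 1 + s * k := by
  classical
  obtain ⟨φ, hφ⟩ := h.exists_equiv hMN hN e
  set m := mkPos i i le_rfl hi with hm
  set D := φ.symm m with hD
  have hDw : JumpSystem.window k J N D = {N + 1 + i} := by
    rw [hφ, hD, Equiv.apply_symm_apply, hm]; simp [mkPos]
  have hbelow : ∀ g, R (cl N) D g ↔ ((φ g).1.1 : ℕ) < i := by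
    intro g
    rcases eq_or_ne D g with rfl | hg
    · refine iff_of_false h.irrefl ?_
      rw [hD, Equiv.apply_symm_apply, hm]; simp [mkPos]
    rw [h.lt_diagonal_iff hMN hN e hDw hg]
    have hp : ((φ g).1.1 : ℕ) ≤ (φ g).1.2 := (φ g).2
    have hlt := (φ g).1.1.isLt
    constructor
    · rintro ⟨x, h1, h2, h3⟩
      have := (JumpSystem.jump_iff_of_window (hφ g) h1 (by omega)).1 h3
      simp only [Finset.mem_insert, Finset.mem_singleton] at this
      omega
    · intro h1
      exact ⟨N + 1 + (φ g).1.1, by omega, by omega,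
        (JumpSystem.jump_iff_of_window (hφ g) (by omega) (by omega)).2 (by simp)⟩
  have hbelow' : ∀ q, R (cl N) (e m) (e q) ↔ (q.1.1 : ℕ) < i := by
    intro q
    constructor
    · intro h1
      by_contra h2
      rcases eq_or_ne q m with rfl | h3
      · exact h.irrefl h1
      · exact h.asymm h1 (he _ _ (diag_lt_posIdx hi (not_lt.mp h2) h3))
    · exact fun h1 => he _ _ (posIdx_lt_diag hi h1)
  have hcard : (Finset.univ.filter fun g => R (cl N) D g).card =
      (Finset.univ.filter fun g => R (cl N) (e m) g).card := by
    refine Finset.card_equiv (φ.trans e) fun g => ?_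
    simp only [Finset.mem_filter, Finset.mem_univ, true_and, Equiv.trans_apply]
    rw [hbelow, hbelow']
  have strict : ∀ f g, R (cl N) f g → (Finset.univ.filter fun x => R (cl N) g x).card <
      (Finset.univ.filter fun x => R (cl N) f x).card := by
    intro f g hfg
    refine Finset.card_lt_card (Finset.ssubset_iff_of_subset ?_ |>.mpr ⟨g, by simpa using hfg, ?_⟩)
    · intro x hx
      rw [Finset.mem_filter] at hx ⊢
      exact ⟨hx.1, h.trans hfg hx.2⟩
    · simpa using h.irrefl
  have hDe : e m = D := by
    by_contra hne
    rcases h.total hne (cl N) with h1 | h1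
    · have := strict _ _ h1; omega
    · have := strict _ _ h1; omega
  rw [hDe]
  have hk := h.two_le
  have hbase : ∀ j, 1 ≤ j → j ≤ k → (J D (N + j) ↔ j = i + 1) := by
    intro j h1 h2
    rw [JumpSystem.jump_iff_of_window hDw (by omega) (by omega), Finset.mem_singleton]
    omega
  induction j using Nat.strong_induction_on with
  | _ j ih =>
    rcases le_or_gt j k with hjk | hjk
    · rw [hbase j hj hjk]
      constructor
      · rintro rfl; exact ⟨0, by simp⟩
      · rintro ⟨s, rfl⟩
        rcases Nat.eq_zero_or_pos s with rfl | hs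
        · simp
        · have := Nat.le_mul_of_pos_left k hs; omega
    · have h1 := h.jump_add_period hMN hN (e := N + (j - k)) (by omega) D
      rw [show N + (j - k) + k = N + j by omega] at h1
      refine h1.trans ((ih (j - k) (by omega) (by omega)).trans ?_)
      constructor
      · rintro ⟨s, hs⟩
        exact ⟨s + 1, by rw [add_mul]; omega⟩
      · rintro ⟨s, rfl⟩
        rcases Nat.eq_zero_or_pos s with rfl | hs
        · omega
        · obtain ⟨s, rfl⟩ : ∃ u, s = u + 1 := ⟨s - 1, by omega⟩
          exact ⟨s, by rw [add_mul] at *; omega⟩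

lemma mu_le_dd (α : ℝ) {q m : ℕ} (hq : 1 ≤ q) (hqm : q ≤ m) : mu α m ≤ dd α q := by
  obtain ⟨r, hrq, hr, hd⟩ := exists_best_le α q hq
  exact (mu_anti α hr.1 (hrq.trans hqm)).trans (hr.mu_eq.trans_le hd)

lemma psi_eq_mu (α : ℝ) {t : ℝ} (ht : 1 ≤ t) : psi α t = mu α ⌊t⌋₊ := by
  have hfl : 1 ≤ ⌊t⌋₊ := Nat.one_le_floor_iff t |>.mpr ht
  refine IsLeast.csInf_eq ⟨⟨(lastBest α ⌊t⌋₊ : ℤ), ⟨?_, ?_⟩, ?_⟩, ?_⟩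
  · exact_mod_cast (lastBest_isBest α hfl).1
  · rw [Int.cast_natCast]
    exact (Nat.cast_le.mpr (lastBest_le α _)).trans (Nat.floor_le (by linarith))
  · simp only [Int.cast_natCast]
    rfl
  · rintro _ ⟨q, ⟨hq1, hqt⟩, rfl⟩
    lift q to ℕ using by omega
    rw [Int.cast_natCast] at hqt
    simp only [Int.cast_natCast]
    exact mu_le_dd α (by exact_mod_cast hq1) (Nat.le_floor hqt)

lemma continuousAt_psi_iff (α : ℝ) {m : ℕ} (hm : 2 ≤ m) :
    ContinuousAt (psi α) m ↔ ¬ IsBest α m := by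
  have hm' : (2 : ℝ) ≤ m := by exact_mod_cast hm
  have hval : psi α m = mu α m := by rw [psi_eq_mu α (by linarith), Nat.floor_natCast]
  have hleft : ∀ t : ℝ, m - 1 ≤ t → t < m → psi α t = mu α (m - 1) := by
    intro t h1 h2
    rw [psi_eq_mu α (by linarith), (Nat.floor_eq_iff (by linarith)).mpr]
    rw [Nat.cast_sub (by omega), Nat.cast_one]
    exact ⟨h1, by linarith⟩
  have hright : ∀ t : ℝ, m ≤ t → t < m + 1 → psi α t = mu α m := fun t h1 h2 => by
    rw [psi_eq_mu α (by linarith), (Nat.floor_eq_iff (by linarith)).mpr ⟨h1, h2⟩]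
  constructor
  · intro hc hb
    have h1 : Filter.Tendsto (psi α) (nhdsWithin (m : ℝ) (Set.Iio m)) (nhds (mu α m)) :=
      hval ▸ hc.tendsto.mono_left nhdsWithin_le_nhds
    have h2 : Filter.Tendsto (psi α) (nhdsWithin (m : ℝ) (Set.Iio m)) (nhds (mu α (m - 1))) := by
      refine tendsto_const_nhds.congr' ?_
      filter_upwards [Ioo_mem_nhdsLT (show (m : ℝ) - 1 < m by linarith)] with t ht
      exact (hleft t ht.1.le ht.2).symm
    exact (hb.mu_lt hm).ne (tendsto_nhds_unique h1 h2)
  · intro hb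
    refine (continuousAt_const (y := mu α m)).congr ?_
    filter_upwards [Ioo_mem_nhds (show (m : ℝ) - 1 < m by linarith)
      (show (m : ℝ) < m + 1 by linarith)] with t ht
    rcases lt_or_ge t m with h | h
    · rw [hleft t ht.1.le h, mu_eq_of_not_isBest (by omega) hb]
    · exact (hright t h ht.2).symm

/-- The order of the values of the irrationality measure functions at the integer `m`. -/
def muOrder {n : ℕ} (α : Fin n → ℝ) (m : ℕ) : Fin n → Fin n → Prop :=
  fun f g => mu (α f) m < mu (α g) m

/-- The orders occurring for arbitrarily large arguments. -/
def recurrentOrders {n : ℕ} (α : Fin n → ℝ) : Set (Fin n → Fin n → Prop) :=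
  {R | ∃ᶠ m in Filter.atTop, muOrder α m = R}

/-- The order relation described by an order vector. -/
def vecOrder {n : ℕ} (v : Fin n → Fin n) : Fin n → Fin n → Prop :=
  fun f g => ∃ p q, p < q ∧ v p = g ∧ v q = f

section Orders

variable {n : ℕ} {α : Fin n → ℝ}

lemma psi_lt_psi_iff {t : ℝ} (ht : 1 ≤ t) (f g : Fin n) :
    psi (α f) t < psi (α g) t ↔ muOrder α ⌊t⌋₊ f g := by
  rw [psi_eq_mu _ ht, psi_eq_mu _ ht]
  rfl

lemma sameOrder_iff {t t' : ℝ} (ht : 1 ≤ t) (ht' : 1 ≤ t') :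
    SameOrder α t t' ↔ muOrder α ⌊t⌋₊ = muOrder α ⌊t'⌋₊ := by
  simp only [SameOrder, psi_lt_psi_iff ht, psi_lt_psi_iff ht', funext_iff, eq_iff_iff]

lemma eventually_muOrder_mem (α : Fin n → ℝ) :
    ∀ᶠ m in Filter.atTop, muOrder α m ∈ recurrentOrders α := by
  have h : ∀ᶠ m in Filter.atTop, ∀ R, muOrder α m = R → R ∈ recurrentOrders α := by
    refine Filter.eventually_all.mpr fun R => ?_
    by_cases hR : R ∈ recurrentOrders α
    · exact Filter.Eventually.of_forall fun _ _ => hR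
    · exact (Filter.not_frequently.mp hR).mono fun _ h1 h2 => absurd h2 h1
  exact h.mono fun m hm => hm _ rfl

lemma IsOrderVec.muOrder_eq {t : ℝ} (ht : 1 ≤ t) {v : Fin n → Fin n} (hv : IsOrderVec α t v) :
    muOrder α ⌊t⌋₊ = vecOrder v := by
  funext f g
  obtain ⟨q, rfl⟩ := hv.1.2 f
  obtain ⟨p, rfl⟩ := hv.1.2 g
  rw [eq_iff_iff, ← psi_lt_psi_iff ht]
  constructor
  · intro h
    refine ⟨p, q, ?_, rfl, rfl⟩
    by_contra hcon
    rcases (not_lt.mp hcon).eq_or_lt with heq | hlt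
    · exact absurd h (heq ▸ lt_irrefl _)
    · exact lt_asymm h (hv.2 _ _ hlt)
  · rintro ⟨p', q', hlt, h1, h2⟩
    rw [← h1, ← h2]
    exact hv.2 _ _ hlt

lemma vecOrder_apply {v : Fin n → Fin n} (hv : Function.Injective v) {p q : Fin n} :
    vecOrder v (v q) (v p) ↔ p < q :=
  ⟨fun ⟨_, _, h, h1, h2⟩ => hv h1 ▸ hv h2 ▸ h, fun h => ⟨p, q, h, rfl, rfl⟩⟩

lemma IsOrderVec.of_muOrder_eq {t : ℝ} (ht : 1 ≤ t) {v : Fin n → Fin n}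
    (hv : Function.Bijective v) (h : muOrder α ⌊t⌋₊ = vecOrder v) : IsOrderVec α t v :=
  ⟨hv, fun _ _ hpq => (psi_lt_psi_iff ht _ _).mpr (h ▸ (vecOrder_apply hv.1).mpr hpq)⟩

lemma vecOrder_injOn : Set.InjOn (vecOrder (n := n)) {v | Function.Bijective v} := by
  intro v hv w hw h
  obtain ⟨σ, hσ⟩ : ∃ σ : Fin n → Fin n, ∀ p, w (σ p) = v p :=
    ⟨fun p => (hw.2 (v p)).choose, fun p => (hw.2 (v p)).choose_spec⟩
  have hmono : StrictMono σ := fun _ _ hpq => by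
    have h1 := (vecOrder_apply hv.1).mpr hpq
    rwa [h, ← hσ, ← hσ, vecOrder_apply hw.1] at h1
  have hid : σ = id := by
    refine (hmono.range_inj strictMono_id).mp ?_
    rw [Set.range_id]
    exact (Finite.surjective_of_injective hmono.injective).range_eq
  funext p
  rw [← hσ, hid, id]

/-- Eventually distinct values can be sorted by an order vector. -/
lemma exists_bijective_vecOrder {m : ℕ} (hm : ∀ f g, f ≠ g → mu (α f) m ≠ mu (α g) m) :
    ∃ v : Fin n → Fin n, Function.Bijective v ∧ muOrder α m = vecOrder v := by
  set x : Fin n → ℝ := fun f => -mu (α f) m with hx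
  have hinj : Function.Injective x := fun f g hfg => by
    by_contra h
    exact hm f g h (neg_injective hfg)
  have hs : StrictMono (x ∘ Tuple.sort x) :=
    (Tuple.monotone_sort x).strictMono_of_injective (hinj.comp (Tuple.sort x).injective)
  refine ⟨Tuple.sort x, (Tuple.sort x).bijective, ?_⟩
  funext f g
  obtain ⟨q, rfl⟩ := (Tuple.sort x).surjective f
  obtain ⟨p, rfl⟩ := (Tuple.sort x).surjective g
  rw [eq_iff_iff, vecOrder_apply (Tuple.sort x).injective, ← hs.lt_iff_lt]
  exact neg_lt_neg_iff.symm

lemma occursInfinitely_iff {v : Fin n → Fin n} :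
    OccursInfinitely α v ↔ Function.Bijective v ∧ vecOrder v ∈ recurrentOrders α := by
  constructor
  · intro h
    refine ⟨(h 0).choose_spec.2.1, Filter.frequently_atTop.mpr fun N => ?_⟩
    obtain ⟨t, ht, hv⟩ := h (N + 1)
    have hN : (0 : ℝ) ≤ N := N.cast_nonneg
    exact ⟨⌊t⌋₊, Nat.le_floor (by linarith), hv.muOrder_eq (by linarith)⟩
  · rintro ⟨hv, hR⟩ T
    obtain ⟨m, hm, hR⟩ := Filter.frequently_atTop.mp hR (⌈|T|⌉₊ + 1)
    have h1 : (⌈|T|⌉₊ : ℝ) + 1 ≤ m := by exact_mod_cast hm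
    have h2 := Nat.le_ceil |T|
    have h3 := le_abs_self T
    have h4 := abs_nonneg T
    exact ⟨m, by linarith,
      IsOrderVec.of_muOrder_eq (by linarith) hv (by rw [Nat.floor_natCast, hR])⟩

lemma card_recurrentOrders {M : ℕ}
    (hM : ∀ m ≥ M, ∀ f g, f ≠ g → mu (α f) m ≠ mu (α g) m) :
    Nat.card (recurrentOrders α) = kAlpha α := by
  have himage : recurrentOrders α = vecOrder '' {v | OccursInfinitely α v} := by
    ext R
    constructor
    · intro hR
      obtain ⟨m, hm, h1⟩ := Filter.frequently_atTop.mp hR M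
      obtain ⟨v, hv, h2⟩ := exists_bijective_vecOrder (hM m hm)
      exact ⟨v, occursInfinitely_iff.mpr ⟨hv, by rwa [← h2, h1]⟩, by rw [← h2, h1]⟩
    · rintro ⟨v, hv, rfl⟩
      exact (occursInfinitely_iff.mp hv).2
  rw [himage, kAlpha]
  exact Nat.card_image_of_injOn
    (vecOrder_injOn.mono fun v hv => (occursInfinitely_iff.mp hv).1)

end Orders

/-- From `T` on the orders are strict and recurrent, and distinct functions never share two
consecutive denominators. -/
structure StrictFrom {n : ℕ} (α : Fin n → ℝ) (T : ℕ) : Prop where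
  irrational : ∀ f, Irrational (α f)
  two_le : 2 ≤ T
  ne : ∀ m ≥ T, ∀ f g, f ≠ g → mu (α f) m ≠ mu (α g) m
  not_consec : ∀ f g, f ≠ g → ∀ t ≥ T, ∀ x, ¬ (Consec (α f) x t ∧ Consec (α g) x t)
  mem : ∀ m ≥ T, muOrder α m ∈ recurrentOrders α

lemma exists_strictFrom {n : ℕ} {α : Fin n → ℝ} (hirr : ∀ f, Irrational (α f))
    (hind : PairwiseIndependent α) : ∃ T, StrictFrom α T := by
  obtain ⟨T₁, -, hT₁⟩ := hind
  have hne : ∀ m ≥ ⌈T₁⌉₊ + 1, ∀ f g, f ≠ g → mu (α f) m ≠ mu (α g) m := by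
    intro m hm f g hfg
    have h1 : (⌈T₁⌉₊ : ℝ) + 1 ≤ m := by exact_mod_cast hm
    have h2 := Nat.le_ceil T₁
    have h3 : (0 : ℝ) ≤ ⌈T₁⌉₊ := Nat.cast_nonneg _
    have := hT₁ m (by linarith) f g hfg
    rwa [psi_eq_mu _ (by linarith), psi_eq_mu _ (by linarith), Nat.floor_natCast] at this
  have hnc : ∀ᶠ t in Filter.atTop, ∀ f g, f ≠ g →
      ∀ x, ¬ (Consec (α f) x t ∧ Consec (α g) x t) := by
    refine Filter.eventually_all.mpr fun f => Filter.eventually_all.mpr fun g => ?_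
    by_cases hfg : f = g
    · exact Filter.Eventually.of_forall fun _ h => absurd hfg h
    obtain ⟨T, hT⟩ := exists_forall_not_consec (hirr f) (hirr g) fun m hm => hne m hm f g hfg
    filter_upwards [Filter.eventually_ge_atTop T] with t ht _ x
    exact hT t ht x
  obtain ⟨T₂, hT₂⟩ := Filter.eventually_atTop.mp (hnc.and (eventually_muOrder_mem α))
  exact ⟨max T₂ (⌈T₁⌉₊ + 2), hirr, by omega, fun m hm => hne m (by omega),
    fun f g hfg t ht => (hT₂ t (by omega)).1 f g hfg, fun m hm => (hT₂ m (by omega)).2⟩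

/-- The arguments after `T` at which the order changes. -/
def IsChange {n : ℕ} (α : Fin n → ℝ) (T m : ℕ) : Prop :=
  T < m ∧ muOrder α m ≠ muOrder α (m - 1)

/-- The sequence of all arguments after `T` at which the order changes. -/
noncomputable def changeTime {n : ℕ} (α : Fin n → ℝ) (T i : ℕ) : ℕ := Nat.nth (IsChange α T) i

section Changes

variable {n : ℕ} {α : Fin n → ℝ} {T : ℕ}

lemma infinite_isChange (hcard : 2 ≤ Nat.card (recurrentOrders α)) :
    (Set.ofPred (IsChange α T)).Infinite := by
  intro hfin
  obtain ⟨B, hB⟩ := hfin.bddAbove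
  have hconst : ∀ m, max B T ≤ m → muOrder α m = muOrder α (max B T) := by
    intro m hm
    induction m, hm using Nat.le_induction with
    | base => rfl
    | succ m hm ih =>
      rw [← ih]
      by_contra h
      have : m + 1 ≤ B := hB (show IsChange α T (m + 1) from ⟨by omega, by simpa using h⟩)
      omega
  have hsub : Subsingleton (recurrentOrders α) := by
    have key : ∀ R ∈ recurrentOrders α, R = muOrder α (max B T) := by
      intro R hR
      obtain ⟨m, hm, rfl⟩ := Filter.frequently_atTop.mp hR (max B T)
      exact hconst m hm
    exact ⟨fun R S => Subtype.ext ((key _ R.2).trans (key _ S.2).symm)⟩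
  have := Finite.card_le_one_iff_subsingleton.mpr hsub
  omega

lemma changeTime_strictMono (hinf : (Set.ofPred (IsChange α T)).Infinite) :
    StrictMono (changeTime α T) := Nat.nth_strictMono hinf

lemma isChange_changeTime (hinf : (Set.ofPred (IsChange α T)).Infinite) (i : ℕ) :
    IsChange α T (changeTime α T i) :=
  Nat.nth_mem_of_infinite hinf i

lemma muOrder_eq_of_between (hinf : (Set.ofPred (IsChange α T)).Infinite) {i m : ℕ}
    (h1 : changeTime α T i ≤ m) (h2 : m < changeTime α T (i + 1)) :
    muOrder α m = muOrder α (changeTime α T i) := by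
  induction m, h1 using Nat.le_induction with
  | base => rfl
  | succ m hm ih =>
    rw [← ih (by omega)]
    by_contra h
    have hT := (isChange_changeTime hinf i).1
    have : m + 1 ≤ changeTime α T i :=
      Nat.le_nth_of_lt_nth_succ h2 ⟨by omega, by simpa using h⟩
    omega

lemma exists_between_changeTime (hinf : (Set.ofPred (IsChange α T)).Infinite) {m : ℕ}
    (hm : changeTime α T 0 ≤ m) :
    ∃ i, changeTime α T i ≤ m ∧ m < changeTime α T (i + 1) := by
  induction m, hm using Nat.le_induction with
  | base => exact ⟨0, le_rfl, changeTime_strictMono hinf Nat.zero_lt_one⟩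
  | succ m hm ih =>
    obtain ⟨i, h1, h2⟩ := ih
    rcases (show m + 1 ≤ _ from h2).eq_or_lt with heq | hlt
    · exact ⟨i + 1, heq.ge, heq ▸ changeTime_strictMono hinf (Nat.lt_succ_self _)⟩
    · exact ⟨i, by omega, hlt⟩

lemma exists_eq_changeTime_succ (hinf : (Set.ofPred (IsChange α T)).Infinite) {m : ℕ}
    (hm : changeTime α T 0 < m) (hne : muOrder α m ≠ muOrder α (m - 1)) :
    ∃ i, m = changeTime α T (i + 1) := by
  obtain ⟨i, hi⟩ : ∃ i, changeTime α T i = m := by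
    have h := Nat.subset_range_nth (p := IsChange α T)
      (show m ∈ Set.ofPred (IsChange α T) from
        ⟨(isChange_changeTime hinf 0).1.trans hm, hne⟩)
    exact h
  cases i with
  | zero => omega
  | succ i => exact ⟨i, hi.symm⟩

lemma muOrder_pred_changeTime (hinf : (Set.ofPred (IsChange α T)).Infinite) (i : ℕ) :
    muOrder α (changeTime α T (i + 1) - 1) = muOrder α (changeTime α T i) := by
  have h := changeTime_strictMono hinf (Nat.lt_add_one i)
  exact muOrder_eq_of_between hinf (by omega) (by omega)

end Changes

lemma IsBest.exists_consec_ge {α : ℝ} {q m : ℕ} (hq : IsBest α q) (hm : IsBest α m)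
    (hqm : q < m) : ∃ x, Consec α x m ∧ q ≤ x := by
  obtain ⟨x, hx⟩ := exists_consec hm (by have := hq.1; omega)
  refine ⟨x, hx, ?_⟩
  by_contra hcon
  exact hx.2.2.2 q (not_le.mp hcon) hqm hq

/-- If three numbers have the consecutive denominators `y < X < b`, `i < X < a` and `y < a < b`
respectively, then the second one is better approximated just before `X` than the first. -/
lemma Consec.dd_lt_of_three {α β γ : ℝ} (ha : Irrational α) (hb : Irrational β)
    (hc : Irrational γ) {i y X a b : ℕ} (hi : 2 ≤ i) (h1 : Consec α y X) (h2 : Consec α X b)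
    (h3 : Consec β i X) (h4 : Consec β X a) (h5 : Consec γ y a) (h6 : Consec γ a b) :
    dd β i < dd α y := by
  obtain ⟨A, -, hA, -⟩ := h1.step ha h2
  obtain ⟨B, hB1, hB, -⟩ := h5.step hc h6
  have hdvd : X ∣ B := by
    refine (h4.coprime hb).dvd_of_dvd_mul_right ⟨A, ?_⟩
    rw [mul_comm X A]
    omega
  have hXa : X * a ≤ b := by
    have := Nat.mul_le_mul_right a (Nat.le_of_dvd hB1 hdvd)
    omega
  have hXa' : (X : ℝ) * a ≤ b := by exact_mod_cast hXa
  have i1 := h1.identity ha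
  have i2 := h2.identity ha
  have i3 := h3.identity hb
  have i4 := h4.identity hb
  have p1 := dd_pos ha h2.2.1.1
  have p2 := dd_pos ha h2.2.2.1.1
  have p3 := dd_pos hb h4.2.1.1
  have p4 := dd_pos hb h4.2.2.1.1
  have p5 := h4.2.1.lt h4.2.2.1 h4.1
  have hX : (0 : ℝ) < X := by exact_mod_cast h2.2.1.1
  have hyX : (y : ℝ) < X := by exact_mod_cast h1.1
  have hXlt : (X : ℝ) < a := by exact_mod_cast h4.1
  have hi' : (2 : ℝ) ≤ i := by exact_mod_cast hi
  have ha0 : (0 : ℝ) < a := hX.trans hXlt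
  have e1 : (b : ℝ) * dd α X < 1 := by have := mul_pos hX p2; linarith
  have e2 : a * (y * dd α X) < 1 := by
    have := mul_le_mul_of_nonneg_right hXa' p1.le
    have := mul_le_mul_of_nonneg_right hyX.le (mul_nonneg ha0.le p1.le)
    linarith
  have e3 : 1 < 2 * (a * dd β X) := by
    have := mul_lt_mul_of_pos_left p5 hX
    have := mul_lt_mul_of_pos_right hXlt p3
    linarith
  have e4 : 2 * (a * dd β X) ≤ a * (i * dd β X) := by
    have := mul_le_mul_of_nonneg_right hi' (mul_nonneg ha0.le p3.le)
    linarith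
  have e5 : y * dd α X < i * dd β X := lt_of_mul_lt_mul_left (by linarith) ha0.le
  exact lt_of_mul_lt_mul_left (by linarith) hX.le

lemma StrictFrom.total {n : ℕ} {α : Fin n → ℝ} {T : ℕ} (hs : StrictFrom α T) {m : ℕ}
    (hm : T ≤ m) {f g : Fin n} (hfg : f ≠ g) : muOrder α m f g ∨ muOrder α m g f :=
  (hs.ne m hm f g hfg).lt_or_gt

section Swap

variable {n : ℕ} {α : Fin n → ℝ} {T : ℕ}

lemma muOrder_pred_of_not_isBest {m : ℕ} (hm : 2 ≤ m) {f g : Fin n} (h : muOrder α m f g)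
    (hf : ¬ IsBest (α f) m) : muOrder α (m - 1) f g := by
  rw [muOrder, ← mu_eq_of_not_isBest (by omega) hf]
  exact lt_of_lt_of_le h (mu_anti _ (by omega) (by omega))

lemma Consec.muOrder_of_lt {m x y t : ℕ} {f g : Fin n} (hx : Consec (α f) x t)
    (hy : Consec (α g) y t) (hd : dd (α f) x < dd (α g) y) (h1 : x ≤ m) (h2 : m < t) :
    muOrder α m f g := by
  rw [muOrder, hx.mu_eq h1 h2]
  refine hd.trans_le ?_
  rw [← hy.mu_pred]
  exact mu_anti _ (hx.2.1.1.trans h1) (by omega)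

lemma StrictFrom.exists_swap_prev (hs : StrictFrom α T)
    (hinf : (Set.ofPred (IsChange α T)).Infinite) {i : ℕ} {f g : Fin n}
    (hfg : muOrder α (changeTime α T i) f g) {x y : ℕ}
    (hx : Consec (α f) x (changeTime α T (i + 1))) (hy : Consec (α g) y (changeTime α T (i + 1)))
    (h0 : changeTime α T 0 < x) :
    ∃ j, x = changeTime α T (j + 1) ∧ muOrder α (changeTime α T j) g f ∧
      ∀ e, j + 1 ≤ e → e ≤ i → muOrder α (changeTime α T e) f g := by
  have hmono := changeTime_strictMono hinf
  have hT := fun i => (isChange_changeTime hinf i).1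
  have hne : f ≠ g := by rintro rfl; exact lt_irrefl _ hfg
  have hd : dd (α f) x < dd (α g) y := by
    rw [← hx.mu_pred, ← hy.mu_pred]
    rwa [← muOrder_pred_changeTime hinf] at hfg
  have hxy : x ≠ y := by
    rintro rfl
    exact hs.not_consec f g hne _ (hT _).le x ⟨hx, hy⟩
  have ht : dd (α f) (changeTime α T (i + 1)) ≠ dd (α g) (changeTime α T (i + 1)) := by
    rw [← hx.2.2.1.mu_eq, ← hy.2.2.1.mu_eq]
    exact hs.ne _ (hT _).le f g hne
  have h2 := hs.two_le
  have hT0 := hT 0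
  have hswap : muOrder α (x - 1) g f :=
    hx.swap_at_prev (hs.irrational f) (hs.irrational g) hy hxy hd ht (by omega)
  have hafter := fun m => hx.muOrder_of_lt (m := m) hy hd
  obtain ⟨j, rfl⟩ := exists_eq_changeTime_succ hinf h0 fun h => by
    rw [← h] at hswap
    exact lt_asymm hswap (hafter _ le_rfl hx.1)
  refine ⟨j, rfl, by rwa [← muOrder_pred_changeTime hinf], fun e h1 h2 => ?_⟩
  exact hafter _ (hmono.monotone h1) (hmono (by omega))

lemma StrictFrom.exists_swap_prev_other (hs : StrictFrom α T)
    (hinf : (Set.ofPred (IsChange α T)).Infinite) {i j : ℕ} {f g : Fin n}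
    (hfg : muOrder α (changeTime α T i) f g) (hfg' : muOrder α (changeTime α T (i + 1)) f g)
    {y : ℕ} (hx : Consec (α f) (changeTime α T (j + 1)) (changeTime α T (i + 1)))
    (hy : Consec (α g) y (changeTime α T (i + 1))) (h0 : changeTime α T 0 < y) :
    ∃ l, l < j ∧ y = changeTime α T (l + 1) ∧ muOrder α (changeTime α T l) f g ∧
      ∀ e, l + 1 ≤ e → e ≤ j → muOrder α (changeTime α T e) g f := by
  have hmono := changeTime_strictMono hinf
  have h2 := hs.two_le
  have hT := fun i => (isChange_changeTime hinf i).1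
  have hT0 := hT 0
  have hd : dd (α f) (changeTime α T (j + 1)) < dd (α g) y := by
    rw [← hx.mu_pred, ← hy.mu_pred]
    rwa [← muOrder_pred_changeTime hinf] at hfg
  have ht : dd (α f) (changeTime α T (i + 1)) < dd (α g) (changeTime α T (i + 1)) := by
    rwa [← hx.2.2.1.mu_eq, ← hy.2.2.1.mu_eq]
  have hyx := hx.lt_of_lt_of_lt (hs.irrational f) (hs.irrational g) hy hd ht
  have hbefore : muOrder α (y - 1) f g :=
    hx.mu_lt_mu_pred (hs.irrational f) (hs.irrational g) hy hyx ht (by omega)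
  obtain ⟨p, hp⟩ := exists_consec hx.2.1 (by have := hT (j + 1); omega)
  have hdp := hx.dd_lt_dd_prev (hs.irrational f) (hs.irrational g) hy hp
  have hafter : ∀ m, y ≤ m → m < changeTime α T (j + 1) → muOrder α m g f := by
    intro m h3 h4
    rw [muOrder, hy.mu_eq h3 (h4.trans hx.1)]
    refine hdp.trans_le ?_
    rw [← hp.mu_pred]
    exact mu_anti _ (hy.2.1.1.trans h3) (by omega)
  obtain ⟨l, rfl⟩ := exists_eq_changeTime_succ hinf h0 fun h => by
    rw [← h] at hbefore
    exact lt_asymm hbefore (hafter _ le_rfl hyx)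
  refine ⟨l, by simpa using hmono.lt_iff_lt.mp hyx, rfl,
    by rwa [← muOrder_pred_changeTime hinf], fun e h3 h4 => ?_⟩
  exact hafter _ (hmono.monotone h3) (hmono (by omega))

end Swap

/-- The irrationality measure functions of a tuple with `k` recurrent orders form a jump system
along the sequence of order changes. -/
lemma StrictFrom.exists_jumpSystem {n k : ℕ} {α : Fin n → ℝ} {T : ℕ} (hs : StrictFrom α T)
    [Fintype (recurrentOrders α)] (hk : 2 ≤ k) (hn : n = k * (k + 1) / 2)
    (hcard : Nat.card (recurrentOrders α) = k)
    (hinf : (Set.ofPred (IsChange α T)).Infinite) :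
    ∃ M, JumpSystem k (fun (c : recurrentOrders α) f g => c.1 f g)
      (fun i => ⟨muOrder α (changeTime α T i), hs.mem _ (isChange_changeTime hinf i).1.le⟩)
      (fun f i => IsBest (α f) (changeTime α T i))
      (fun f a b => Consec (α f) (changeTime α T a) (changeTime α T b)) M := by
  have hmono := changeTime_strictMono hinf
  have hT := fun i => (isChange_changeTime hinf i).1
  have h2 := hs.two_le
  have hlate : ∀ (c : recurrentOrders α) N, ∃ m, N ≤ m ∧ T ≤ m ∧ muOrder α m = c.1 := by
    intro c N
    obtain ⟨m, hm, h⟩ := Filter.frequently_atTop.mp c.2 (max N T)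
    exact ⟨m, by omega, by omega, h⟩
  choose q hq hq' using fun f => exists_best_gt (hs.irrational f) (changeTime α T 0)
  have hprev : ∀ i, Finset.univ.sup q ≤ i → ∀ f, IsBest (α f) (changeTime α T (i + 1)) →
      ∃ x, Consec (α f) x (changeTime α T (i + 1)) ∧ changeTime α T 0 < x := by
    intro i hi f hf
    have h3 := Finset.le_sup (f := q) (Finset.mem_univ f)
    have h4 := hmono.le_apply (x := i + 1)
    obtain ⟨x, hx, hqx⟩ := (hq' f).exists_consec_ge hf (by omega)
    exact ⟨x, hx, (hq f).trans_le hqx⟩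
  refine ⟨Finset.univ.sup q, ⟨hk, by rw [Fintype.card_fin, hn],
    by rw [← Nat.card_eq_fintype_card, hcard], ?_, ?_, ?_, ?_, ?_, ?_, ?_, ?_, ?_, ?_, ?_, ?_, ?_,
    ?_⟩⟩
  · rintro c f g h
    obtain ⟨m, -, -, hm⟩ := hlate c 0
    rw [← hm] at h ⊢
    exact lt_asymm h
  · rintro c f g l h h'
    obtain ⟨m, -, -, hm⟩ := hlate c 0
    rw [← hm] at h h' ⊢
    exact lt_trans h h'
  · rintro f g hfg c
    obtain ⟨m, -, hTm, hm⟩ := hlate c 0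
    rw [← hm]
    exact hs.total hTm hfg
  · intro i h
    refine (isChange_changeTime hinf (i + 1)).2 ?_
    rw [muOrder_pred_changeTime hinf]
    exact (congrArg Subtype.val h).symm
  · intro c N
    obtain ⟨m, hm, -, h⟩ := hlate c (changeTime α T N)
    obtain ⟨i, h3, h4⟩ := exists_between_changeTime hinf ((hmono.monotone N.zero_le).trans hm)
    refine ⟨i, ?_, Subtype.ext ?_⟩
    · exact Nat.lt_succ_iff.mp (hmono.lt_iff_lt.mp (hm.trans_lt h4))
    · rw [← h, muOrder_eq_of_between hinf h3 h4]
  · intro f g hfg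
    obtain ⟨m, hm, hle⟩ := exists_mu_le (hs.irrational f) (hs.irrational g) T
    exact ⟨⟨muOrder α m, hs.mem m hm⟩, lt_of_le_of_ne hle (hs.ne m hm f g hfg)⟩
  · intro i f g h hf
    have := hT (i + 1)
    have h3 := muOrder_pred_of_not_isBest (by omega) h hf
    rwa [muOrder_pred_changeTime hinf] at h3
  · exact fun h => hmono.lt_iff_lt.mp h.1
  · exact fun h => h.2.1
  · exact fun h e h3 h4 => h.2.2.2 _ (hmono h3) (hmono h4)
  · intro f g i j hf hg
    by_contra hfg
    exact hs.not_consec f g hfg _ (hT j).le _ ⟨hf, hg⟩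
  · intro i f g hi hf hg hfg
    obtain ⟨x, hx, h0⟩ := hprev i hi f hf
    obtain ⟨y, hy, -⟩ := hprev i hi g hg
    obtain ⟨j, rfl, h3⟩ := hs.exists_swap_prev hinf hfg hx hy h0
    exact ⟨j, hx, h3⟩
  · intro i j f g hi hf hg hfg hfg' hx
    obtain ⟨y, hy, h0⟩ := hprev i hi g hg
    obtain ⟨l, hl, rfl, h3⟩ := hs.exists_swap_prev_other hinf hfg hfg' hx hy h0
    exact ⟨l, hl, hy, h3⟩
  · intro i y x a b g g' g'' _ _ _ _ h3 h4 h5 h6 h7 h8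
    have h9 := Consec.dd_lt_of_three (hs.irrational g) (hs.irrational g') (hs.irrational g'')
      (h2.trans (hT i).le) h3 h4 h5 h6 h7 h8
    rw [← h3.mu_pred, ← h5.mu_pred] at h9
    change muOrder α _ g' g at h9
    rwa [muOrder_pred_changeTime hinf] at h9

/-- After a time `t` the order changes for the first time at the next change time. -/
lemma isLeast_changeTime {n : ℕ} {α : Fin n → ℝ} {T c : ℕ}
    (hinf : (Set.ofPred (IsChange α T)).Infinite) {t : ℝ} (ht : 1 ≤ t)
    (h1 : changeTime α T c ≤ ⌊t⌋₊) (h2 : ⌊t⌋₊ < changeTime α T (c + 1)) :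
    IsLeast {t' : ℝ | t < t' ∧ ¬ SameOrder α t t'} (changeTime α T (c + 1)) := by
  have ht0 : (0 : ℝ) ≤ t := by linarith
  have hlt : t < changeTime α T (c + 1) := (Nat.floor_lt ht0).mp h2
  refine ⟨⟨hlt, ?_⟩, ?_⟩
  · rw [sameOrder_iff ht (by linarith), Nat.floor_natCast, muOrder_eq_of_between hinf h1 h2,
      ← muOrder_pred_changeTime hinf]
    exact (isChange_changeTime hinf (c + 1)).2.symm
  · rintro t' ⟨h3, h4⟩
    by_contra hcon
    refine h4 ((sameOrder_iff ht (by linarith)).mpr ?_)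
    rw [muOrder_eq_of_between hinf h1 h2, muOrder_eq_of_between hinf (m := ⌊t'⌋₊)]
    · exact h1.trans (Nat.floor_mono h3.le)
    · exact (Nat.floor_lt (by linarith)).mpr (not_le.mp hcon)

lemma IsChangeSeq.eq_changeTime {n : ℕ} {α : Fin n → ℝ} {T c : ℕ}
    (hinf : (Set.ofPred (IsChange α T)).Infinite) {ts : ℕ → ℝ} (hts : IsChangeSeq α ts)
    (ht : 1 ≤ ts 0) (h1 : changeTime α T c ≤ ⌊ts 0⌋₊) (h2 : ⌊ts 0⌋₊ < changeTime α T (c + 1))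
    (j : ℕ) : ts (j + 1) = changeTime α T (c + (j + 1)) := by
  induction j with
  | zero => exact (hts 0).unique (isLeast_changeTime hinf ht h1 h2)
  | succ j ih =>
    have h3 := changeTime_strictMono hinf (Nat.lt_add_one (c + (j + 1)))
    have h4 := (isChange_changeTime hinf (c + (j + 1))).1
    refine (hts (j + 1)).unique ?_
    rw [ih]
    refine isLeast_changeTime hinf ?_ (Nat.floor_natCast _).ge ?_
    · exact_mod_cast (by omega : 1 ≤ changeTime α T (c + (j + 1)))
    · rwa [Nat.floor_natCast]

/-- **Theorem (Main), item (iii).** Each diagonal function `ψ_{i,i}` jumps exactly at the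
moments `t_{i+sk}` among the moments of permutation changes. (`0`-based: `i` below is
the paper's `i - 1`.) -/
theorem stmt12 (k : ℕ) (hk : 2 ≤ k) (n : ℕ) (hn : n = k * (k + 1) / 2)
    (α : Fin n → ℝ) (hirr : ∀ i, Irrational (α i)) (hind : PairwiseIndependent α)
    (hka : kAlpha α = k) :
    ∃ T : ℝ, 1 < T ∧ ∀ t0 : ℝ, T ≤ t0 → ∀ ts : ℕ → ℝ, ts 0 = t0 → IsChangeSeq α ts →
      ∀ e : PairIdx k → Fin n, IsOrderVecP α t0 e →
        ∀ i : ℕ, ∀ hi : i < k,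
          (∀ s : ℕ, ¬ ContinuousAt (psi (α (e (mkPos i i le_rfl hi)))) (ts (i + 1 + s * k))) ∧
          (∀ j : ℕ, 1 ≤ j → (∀ s : ℕ, j ≠ i + 1 + s * k) →
            ContinuousAt (psi (α (e (mkPos i i le_rfl hi)))) (ts j)) := by
  obtain ⟨T, hs⟩ := exists_strictFrom hirr hind
  have hcard : Nat.card (recurrentOrders α) = k := (card_recurrentOrders hs.ne).trans hka
  have hinf := infinite_isChange (T := T) (hk.trans_eq hcard.symm)
  have := Fintype.ofFinite (recurrentOrders α)
  obtain ⟨M, hM⟩ := hs.exists_jumpSystem hk hn hcard hinf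
  obtain ⟨N, hMN, hN⟩ := hM.exists_periodic
  have hmono := changeTime_strictMono hinf
  have hT := fun i => (isChange_changeTime hinf i).1
  have h2T := hs.two_le
  have hTN : 1 < changeTime α T N := by have := hT N; omega
  refine ⟨changeTime α T N, by exact_mod_cast hTN, ?_⟩
  intro t0 ht0 ts hts0 hts e he i hi
  subst hts0
  have ht1 : 1 ≤ ts 0 := le_trans (by exact_mod_cast hTN.le) ht0
  have hfl : changeTime α T N ≤ ⌊ts 0⌋₊ := Nat.le_floor ht0
  obtain ⟨c, h1, h2⟩ := exists_between_changeTime hinf ((hmono.monotone N.zero_le).trans hfl)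
  have hNc : N ≤ c := Nat.lt_succ_iff.mp (hmono.lt_iff_lt.mp (hfl.trans_lt h2))
  have hcont : ∀ j, 1 ≤ j → (ContinuousAt (psi (α (e (mkPos i i le_rfl hi)))) (ts j) ↔
      ¬ ∃ s, j = i + 1 + s * k) := by
    intro j hj
    have hjump := hM.diagonal_jump_iff (hMN.trans hNc) (fun i hi => hN i (hNc.trans hi))
      (Equiv.ofBijective e he.1) (fun p q hpq => by
        have h3 := (psi_lt_psi_iff ht1 _ _).mp (he.2 p q hpq)
        rwa [muOrder_eq_of_between hinf h1 h2] at h3) hi hj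
    obtain ⟨j, rfl⟩ : ∃ l, j = l + 1 := ⟨j - 1, by omega⟩
    rw [hts.eq_changeTime hinf ht1 h1 h2, continuousAt_psi_iff _ (h2T.trans (hT _).le)]
    exact hjump.not
  refine ⟨fun s => ?_, fun j hj hjs => (hcont j hj).mpr fun ⟨s, h⟩ => hjs s h⟩
  rw [hcont _ (by omega), not_not]
  exact ⟨s, rfl⟩
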